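/- Let d, x, y, z be non-negative integers with d ≥ 9. Then the linear system L_3(d; 4^{×x}, 3^{×y}, 2^{×z}) is non-special; that is, there exist pairwise linearly independent points p_1,...,p_{x+y+z} ∈ ℚ^4 \ {0} such that the space of homogeneous polynomials of degree d in 4 variables over ℚ vanishing to order ≥ 4 at the first x points, ≥ 3 at the next y points, and ≥ 2 at the last z points has dimension exactly max(C(d+3,3) − 20x − 10y − 4z, 0). -/

import Mathlib

open MvPolynomial

/-- The differential operator `∂₀^{ν 0} ∂₁^{ν 1} ∂₂^{ν 2} ∂₃^{ν 3}` on polynomials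
in 4 variables over `ℚ`. -/
noncomputable def diffOp (ν : Fin 4 → ℕ) :
    Module.End ℚ (MvPolynomial (Fin 4) ℚ) :=
  ((pderiv (0 : Fin 4)).toLinearMap ^ ν 0) * ((pderiv (1 : Fin 4)).toLinearMap ^ ν 1) *
    ((pderiv (2 : Fin 4)).toLinearMap ^ ν 2) * ((pderiv (3 : Fin 4)).toLinearMap ^ ν 3)

/-- Polynomials all of whose partial derivatives of order `< m` (including order 0)
vanish at the point `pt : ℚ⁴`. -/
noncomputable def vanishingSpace (m : ℕ) (pt : Fin 4 → ℚ) :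
    Submodule ℚ (MvPolynomial (Fin 4) ℚ) :=
  ⨅ (ν : Fin 4 → ℕ) (_ : ∑ j, ν j < m),
    LinearMap.ker ((aeval pt).toLinearMap ∘ₗ
      (diffOp ν : MvPolynomial (Fin 4) ℚ →ₗ[ℚ] MvPolynomial (Fin 4) ℚ))

/-- `V(d; m_1,…,m_r; p_1,…,p_r)`: homogeneous polynomials of degree `d` in 4 variables
over `ℚ` vanishing to order `≥ ms[i]` at `pts i` for each `i`. -/
noncomputable def systemSpace (d : ℕ) (ms : List ℕ) (pts : Fin ms.length → Fin 4 → ℚ) :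
    Submodule ℚ (MvPolynomial (Fin 4) ℚ) :=
  homogeneousSubmodule (Fin 4) ℚ d ⊓ ⨅ i, vanishingSpace (ms.get i) (pts i)

/-- The virtual dimension `vdim L_3(d; m_1,…,m_r) = C(d+3,3) − Σ C(m_i+2,3) − 1`. -/
def vdim (d : ℕ) (ms : List ℕ) : ℤ :=
  ((d + 3).choose 3 : ℤ) - (ms.map fun m => ((m + 2).choose 3 : ℤ)).sum - 1

/-- The linear system `L_3(d; m_1,…,m_r)` is non-special: there exist pairwise linearly
independent points of `ℚ⁴ \ {0}` at which the space of degree-`d` homogeneous polynomials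
with the prescribed multiplicities has dimension `max (vdim + 1) 0`
(the expected dimension). -/
noncomputable def nonSpecial (d : ℕ) (ms : List ℕ) : Prop :=
  ∃ pts : Fin ms.length → Fin 4 → ℚ,
    (∀ i, pts i ≠ 0) ∧
    (∀ i j, i ≠ j → LinearIndependent ℚ ![pts i, pts j]) ∧
    (Module.finrank ℚ (systemSpace d ms pts) : ℤ) = max (vdim d ms + 1) 0

/-! ## Interpolation on finite sets of lattice points -/

/-- Lattice points (exponents of Laurent monomials in three variables). -/
abbrev Z3 := ℤ × ℤ × ℤ
/-- Points of affine three-space. -/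
abbrev Q3 := ℚ × ℚ × ℚ

def mon (i j k : ℕ) (δ : Z3) : ℚ := (δ.1 : ℚ) ^ i * (δ.2.1 : ℚ) ^ j * (δ.2.2 : ℚ) ^ k

def chr (p : Q3) (δ : Z3) : ℚ := p.1 ^ δ.1 * p.2.1 ^ δ.2.1 * p.2.2 ^ δ.2.2

def tor (p : Q3) : Prop := p.1 ≠ 0 ∧ p.2.1 ≠ 0 ∧ p.2.2 ≠ 0

def Cond (D : Finset Z3) (c : Z3 → ℚ) (Q : Multiset (ℕ × Q3)) : Prop :=
  ∀ mp ∈ Q, ∀ i j k : ℕ, i + j + k < mp.1 → ∑ δ ∈ D, c δ * (mon i j k δ * chr mp.2 δ) = 0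

def Inj (D : Finset Z3) (ms : Multiset ℕ) : Prop :=
  ∃ Q : Multiset (ℕ × Q3), Q.map Prod.fst = ms ∧ (Q.map Prod.snd).Nodup ∧
    (∀ mp ∈ Q, tor mp.2) ∧ ∀ c, Cond D c Q → ∀ δ ∈ D, c δ = 0

/-- Polynomial functions of degree `< m`. -/
def Pol (m : ℕ) : Submodule ℚ (Z3 → ℚ) :=
  Submodule.span ℚ {f | ∃ i j k : ℕ, i + j + k < m ∧ f = mon i j k}

theorem mon_mem_Pol {m i j k : ℕ} (h : i + j + k < m) : mon i j k ∈ Pol m :=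
  Submodule.subset_span ⟨i, j, k, h, rfl⟩

theorem Pol_mono {m n : ℕ} (h : m ≤ n) : Pol m ≤ Pol n := by
  apply Submodule.span_mono
  rintro f ⟨i, j, k, hh, rfl⟩
  exact ⟨i, j, k, by omega, rfl⟩

theorem Pol_mul_x {m : ℕ} {f : Z3 → ℚ} (hf : f ∈ Pol m) :
    (fun δ => (δ.1 : ℚ) * f δ) ∈ Pol (m + 1) := by
  induction hf using Submodule.span_induction with
  | mem f hf =>
    obtain ⟨i, j, k, h, rfl⟩ := hf
    have : (fun δ : Z3 => (δ.1 : ℚ) * mon i j k δ) = mon (i + 1) j k := by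
      funext δ; simp only [mon]; ring
    rw [this]; exact mon_mem_Pol (by omega)
  | zero => convert (Pol (m+1)).zero_mem using 1; funext δ; simp
  | add f g _ _ hf hg => convert (Pol (m+1)).add_mem hf hg using 1; funext δ; simp [mul_add]
  | smul a f _ hf => convert (Pol (m+1)).smul_mem a hf using 1; funext δ; simp; ring

theorem Pol_mul_y {m : ℕ} {f : Z3 → ℚ} (hf : f ∈ Pol m) :
    (fun δ => (δ.2.1 : ℚ) * f δ) ∈ Pol (m + 1) := by
  induction hf using Submodule.span_induction with
  | mem f hf =>
    obtain ⟨i, j, k, h, rfl⟩ := hf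
    have : (fun δ : Z3 => (δ.2.1 : ℚ) * mon i j k δ) = mon i (j + 1) k := by
      funext δ; simp only [mon]; ring
    rw [this]; exact mon_mem_Pol (by omega)
  | zero => convert (Pol (m+1)).zero_mem using 1; funext δ; simp
  | add f g _ _ hf hg => convert (Pol (m+1)).add_mem hf hg using 1; funext δ; simp [mul_add]
  | smul a f _ hf => convert (Pol (m+1)).smul_mem a hf using 1; funext δ; simp; ring

theorem Pol_mul_z {m : ℕ} {f : Z3 → ℚ} (hf : f ∈ Pol m) :
    (fun δ => (δ.2.2 : ℚ) * f δ) ∈ Pol (m + 1) := by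
  induction hf using Submodule.span_induction with
  | mem f hf =>
    obtain ⟨i, j, k, h, rfl⟩ := hf
    have : (fun δ : Z3 => (δ.2.2 : ℚ) * mon i j k δ) = mon i j (k + 1) := by
      funext δ; simp only [mon]; ring
    rw [this]; exact mon_mem_Pol (by omega)
  | zero => convert (Pol (m+1)).zero_mem using 1; funext δ; simp
  | add f g _ _ hf hg => convert (Pol (m+1)).add_mem hf hg using 1; funext δ; simp [mul_add]
  | smul a f _ hf => convert (Pol (m+1)).smul_mem a hf using 1; funext δ; simp; ring

/-- Multiplying by a function of degree at most one raises the degree by one. -/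
theorem Pol_mul_affine {m : ℕ} {f : Z3 → ℚ} (hf : f ∈ Pol m) (a b c e : ℚ) :
    (fun δ => (a * δ.1 + b * δ.2.1 + c * δ.2.2 + e) * f δ) ∈ Pol (m + 1) := by
  have h1 := (Pol (m+1)).smul_mem a (Pol_mul_x hf)
  have h2 := (Pol (m+1)).smul_mem b (Pol_mul_y hf)
  have h3 := (Pol (m+1)).smul_mem c (Pol_mul_z hf)
  have h4 := (Pol (m+1)).smul_mem e (Pol_mono (Nat.le_succ m) hf)
  convert (Pol (m+1)).add_mem ((Pol (m+1)).add_mem ((Pol (m+1)).add_mem h1 h2) h3) h4 using 1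
  funext δ
  simp only [Pi.add_apply, Pi.smul_apply, smul_eq_mul]
  ring

theorem one_mem_Pol : (fun _ => 1 : Z3 → ℚ) ∈ Pol 1 := by
  have : (fun _ => 1 : Z3 → ℚ) = mon 0 0 0 := by funext δ; simp [mon]
  rw [this]; exact mon_mem_Pol (by omega)

theorem mon_shift_mem (s : Z3) (i j k : ℕ) :
    (fun δ : Z3 => mon i j k (δ - s)) ∈ Pol (i + j + k + 1) := by
  induction i with
  | succ i ih =>
    have := Pol_mul_affine ih 1 0 0 (-(s.1 : ℚ))
    convert Pol_mono (show i + j + k + 1 + 1 ≤ i + 1 + j + k + 1 by omega) this using 1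
    funext δ; simp [mon]; ring
  | zero =>
    induction j with
    | succ j ih =>
      have := Pol_mul_affine ih 0 1 0 (-(s.2.1 : ℚ))
      convert Pol_mono (show 0 + j + k + 1 + 1 ≤ 0 + (j + 1) + k + 1 by omega) this using 1
      funext δ; simp [mon]; ring
    | zero =>
      induction k with
      | succ k ih =>
        have := Pol_mul_affine ih 0 0 1 (-(s.2.2 : ℚ))
        convert Pol_mono (show 0 + 0 + k + 1 + 1 ≤ 0 + 0 + (k + 1) + 1 by omega) this using 1
        funext δ; simp [mon]; ring
      | zero =>
        convert one_mem_Pol using 1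
        funext δ; simp [mon]

theorem sum_eq_zero_of_Pol {D : Finset Z3} {c : Z3 → ℚ} {p : Q3} {m : ℕ}
    (h : ∀ i j k : ℕ, i + j + k < m → ∑ δ ∈ D, c δ * (mon i j k δ * chr p δ) = 0)
    {f : Z3 → ℚ} (hf : f ∈ Pol m) : ∑ δ ∈ D, c δ * (f δ * chr p δ) = 0 := by
  induction hf using Submodule.span_induction with
  | mem f hf => obtain ⟨i, j, k, hh, rfl⟩ := hf; exact h i j k hh
  | zero => simp
  | add f g _ _ hf hg =>
    simp only [Pi.add_apply, add_mul, mul_add, Finset.sum_add_distrib, hf, hg, add_zero]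
  | smul a f _ hf =>
    have : ∀ δ, c δ * ((a • f) δ * chr p δ) = a * (c δ * (f δ * chr p δ)) := by
      intro δ; simp; ring
    simp only [this, ← Finset.mul_sum, hf, mul_zero]

theorem chr_add {p : Q3} (hp : tor p) (δ s : Z3) : chr p (δ + s) = chr p δ * chr p s := by
  obtain ⟨h1, h2, h3⟩ := hp
  simp only [chr, Prod.fst_add, Prod.snd_add, zpow_add₀ h1, zpow_add₀ h2, zpow_add₀ h3]
  ring

theorem chr_ne_zero {p : Q3} (hp : tor p) (δ : Z3) : chr p δ ≠ 0 := by
  obtain ⟨h1, h2, h3⟩ := hp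
  simp only [chr]
  positivity

theorem Inj.shift {D : Finset Z3} {ms : Multiset ℕ} (h : Inj D ms) {E : Finset Z3} (s : Z3)
    (hE : ∀ δ, δ ∈ E ↔ δ - s ∈ D) : Inj E ms := by
  obtain ⟨Q, h1, h2, h3, h4⟩ := h
  refine ⟨Q, h1, h2, h3, fun c hc δ hδ => ?_⟩
  have key : ∀ f : Z3 → ℚ, ∑ δ ∈ E, f δ = ∑ δ ∈ D, f (δ + s) := by
    intro f
    apply Finset.sum_bij' (fun δ _ => δ - s) (fun δ _ => δ + s)
    · intro a ha; exact (hE a).1 ha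
    · intro a ha; rw [hE]; simpa using ha
    · intro a _; simp
    · intro a _; simp
    · intro a _; simp
  have := h4 (fun δ => c (δ + s)) ?_ (δ - s) ((hE δ).1 hδ)
  · simpa using this
  · intro mp hmp i j k hijk
    have e1 := sum_eq_zero_of_Pol (hc mp hmp)
      (Pol_mono (by omega) (mon_shift_mem s i j k))
    rw [key] at e1
    simp only [chr_add (h3 mp hmp), add_sub_cancel_right] at e1
    have e2 : (∑ δ ∈ D, c (δ + s) * (mon i j k δ * chr mp.2 δ)) * chr mp.2 s = 0 := by
      rw [Finset.sum_mul, ← e1]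
      exact Finset.sum_congr rfl fun δ _ => by ring
    exact (mul_eq_zero.1 e2).resolve_right (chr_ne_zero (h3 mp hmp) s)

/-! ### The cutting lemma -/

def dot (w δ : Z3) : ℤ := w.1 * δ.1 + w.2.1 * δ.2.1 + w.2.2 * δ.2.2

def scl (t : ℚ) (w : Z3) (p : Q3) : Q3 := (t ^ w.1 * p.1, t ^ w.2.1 * p.2.1, t ^ w.2.2 * p.2.2)

theorem chr_scl {t : ℚ} (ht : t ≠ 0) (w : Z3) (p : Q3) (δ : Z3) :
    chr (scl t w p) δ = t ^ dot w δ * chr p δ := by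
  simp only [chr, scl, dot, mul_zpow, zpow_add₀ ht, ← zpow_mul]
  ring

theorem tor_scl {t : ℚ} (ht : t ≠ 0) (w : Z3) {p : Q3} (hp : tor p) : tor (scl t w p) := by
  obtain ⟨h1, h2, h3⟩ := hp
  exact ⟨mul_ne_zero (zpow_ne_zero _ ht) h1, mul_ne_zero (zpow_ne_zero _ ht) h2,
    mul_ne_zero (zpow_ne_zero _ ht) h3⟩

theorem scl_inj {t : ℚ} (ht : t ≠ 0) (w : Z3) : Function.Injective (scl t w) := by
  rintro ⟨a, b, c⟩ ⟨a', b', c'⟩ h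
  simp only [scl, Prod.mk.injEq] at h
  obtain ⟨h1, h2, h3⟩ := h
  rw [mul_right_inj' (zpow_ne_zero _ ht)] at h1 h2 h3
  subst h1; subst h2; subst h3; rfl

theorem scl_eq_finite {w : Z3} (hw : w ≠ 0) {p q : Q3} (hp : tor p) :
    {t : ℚ | 0 < t ∧ scl t w p = q}.Finite := by
  apply Set.Subsingleton.finite
  rintro t ⟨ht, h⟩ t' ⟨ht', h'⟩
  rw [← h'] at h
  simp only [scl, Prod.mk.injEq] at h
  obtain ⟨p1, p2, p3⟩ := hp
  rw [mul_left_inj' p1, mul_left_inj' p2, mul_left_inj' p3] at h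
  have : w.1 ≠ 0 ∨ w.2.1 ≠ 0 ∨ w.2.2 ≠ 0 := by
    by_contra hh
    push Not at hh
    exact hw (Prod.ext hh.1 (Prod.ext hh.2.1 hh.2.2))
  have key : ∀ n : ℤ, n ≠ 0 → t ^ n = t' ^ n → t = t' := fun n hn h =>
    (zpow_left_inj₀ ht.le ht'.le hn).1 h
  rcases this with h0 | h0 | h0
  · exact key _ h0 h.1
  · exact key _ h0 h.2.1
  · exact key _ h0 h.2.2

/-- A row of the interpolation matrix. -/
def rowf (ρ : Q3 × ℕ × ℕ × ℕ) (δ : Z3) : ℚ := mon ρ.2.1 ρ.2.2.1 ρ.2.2.2 δ * chr ρ.1 δ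

theorem exists_rows {ι : Type*} [Fintype ι] [DecidableEq ι] (S : Set (ι → ℚ))
    (h : ∀ c : ι → ℚ, (∀ s ∈ S, ∑ i, c i * s i = 0) → c = 0) :
    ∃ r : ι → ι → ℚ, (∀ i, r i ∈ S) ∧ (Matrix.of r).det ≠ 0 := by
  have hspan : Submodule.span ℚ S = ⊤ := by
    by_contra hne
    obtain ⟨f, hf, hle⟩ := Submodule.exists_le_ker_of_lt_top _ (lt_top_iff_ne_top.2 hne)
    apply hf
    have hc := h (fun i => f (Pi.single i 1)) (fun s hs => by
      have h0 : f s = 0 := hle (Submodule.subset_span hs)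
      rw [LinearMap.pi_apply_eq_sum_univ f s] at h0
      rw [← h0]
      refine Finset.sum_congr rfl fun i _ => ?_
      rw [smul_eq_mul, mul_comm]
      congr 3
      funext j
      simp [Pi.single_apply, eq_comm])
    refine LinearMap.pi_ext' fun i => LinearMap.ext_ring ?_
    simpa using congrFun hc i
  obtain ⟨b, hbS, hb, hli⟩ := exists_linearIndependent ℚ S
  rw [hspan] at hb
  let B := Module.Basis.mk hli (by rw [Subtype.range_coe]; exact hb.ge)
  let e := B.indexEquiv (Pi.basisFun ℚ ι)
  refine ⟨fun i => (e.symm i : ι → ℚ), fun i => hbS (e.symm i).2, ?_⟩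
  have : LinearIndependent ℚ (Matrix.of fun i => (e.symm i : ι → ℚ)).row := by
    exact hli.comp _ e.symm.injective
  rw [Matrix.linearIndependent_rows_iff_isUnit] at this
  exact ((Matrix.isUnit_iff_isUnit_det _).1 this).ne_zero

theorem exists_rho {D : Finset Z3} {Q : Multiset (ℕ × Q3)}
    (h : ∀ c, Cond D c Q → ∀ δ ∈ D, c δ = 0) :
    ∃ ρ : D → Q3 × ℕ × ℕ × ℕ,
      (∀ a, ∃ m, (m, (ρ a).1) ∈ Q ∧ (ρ a).2.1 + (ρ a).2.2.1 + (ρ a).2.2.2 < m) ∧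
      (Matrix.of fun a b : D => rowf (ρ a) b).det ≠ 0 := by
  obtain ⟨r, hr, hdet⟩ := exists_rows (ι := D)
    {s | ∃ ρ : Q3 × ℕ × ℕ × ℕ, (∃ m, (m, ρ.1) ∈ Q ∧ ρ.2.1 + ρ.2.2.1 + ρ.2.2.2 < m) ∧
      s = fun b : D => rowf ρ b} (by
    intro c hc
    classical
    funext a
    have := h (fun δ => if hδ : δ ∈ D then c ⟨δ, hδ⟩ else 0) (by
      intro mp hmp i j k hijk
      have h0 := hc _ ⟨(mp.2, i, j, k), ⟨mp.1, hmp, hijk⟩, rfl⟩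
      rw [← h0, ← Finset.sum_attach]
      refine Finset.sum_congr rfl fun x _ => ?_
      simp [rowf]) a a.2
    simpa using this)
  choose ρ hρ hρ' using hr
  refine ⟨ρ, hρ, ?_⟩
  have : (Matrix.of fun a b : D => rowf (ρ a) b) = Matrix.of r := by
    ext a b; simp [hρ' a]
  rwa [this]

theorem Inj.cut {D : Finset Z3} {ms1 ms2 : Multiset ℕ} (w : Z3) (hw : w ≠ 0) (τ : ℤ)
    (h1 : Inj (D.filter fun δ => dot w δ < τ) ms1)
    (h2 : Inj (D.filter fun δ => ¬ dot w δ < τ) ms2) : Inj D (ms1 + ms2) := by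
  obtain ⟨Q1, a1, b1, c1, d1⟩ := h1
  obtain ⟨Q2, a2, b2, c2, d2⟩ := h2
  set D1 := D.filter fun δ => dot w δ < τ with hD1
  set D2 := D.filter fun δ => ¬ dot w δ < τ with hD2
  obtain ⟨ρ1, hρ1, det1⟩ := exists_rho d1
  obtain ⟨ρ2, hρ2, det2⟩ := exists_rho d2
  have m1 : ∀ b : D1, dot w b < τ := fun b => (Finset.mem_filter.1 b.2).2
  have m2 : ∀ b : D2, τ ≤ dot w b := fun b => not_lt.1 (Finset.mem_filter.1 b.2).2
  let M : Matrix (D1 ⊕ D2) (D1 ⊕ D2) (Polynomial ℚ) := Matrix.fromBlocks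
    (Matrix.of fun a b : D1 => Polynomial.C (rowf (ρ1 a) b))
    (Matrix.of fun (a : D1) (b : D2) => Polynomial.C (rowf (ρ1 a) b) * Polynomial.X ^ (dot w b - τ).toNat)
    (Matrix.of fun (a : D2) (b : D1) => Polynomial.C (rowf (ρ2 a) b) * Polynomial.X ^ (τ - dot w b).toNat)
    (Matrix.of fun a b : D2 => Polynomial.C (rowf (ρ2 a) b))
  have hM0 : M.det.eval 0 ≠ 0 := by
    have e : M.det.eval 0 = (M.map (Polynomial.evalRingHom 0)).det := by
      rw [← Polynomial.coe_evalRingHom, RingHom.map_det]; rfl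
    rw [e]
    have : M.map (Polynomial.evalRingHom 0) = Matrix.fromBlocks
      (Matrix.of fun a b : D1 => rowf (ρ1 a) b)
      (Matrix.of fun (a : D1) (b : D2) => (Polynomial.C (rowf (ρ1 a) b) * Polynomial.X ^ (dot w b - τ).toNat).eval 0)
      0 (Matrix.of fun a b : D2 => rowf (ρ2 a) b) := by
      ext a b
      rcases a with a | a <;> rcases b with b | b
      · simp [M]
      · simp [M]
      · have := m1 b
        simp [M, Matrix.fromBlocks]
        right; omega
      · simp [M]
    rw [this, Matrix.det_fromBlocks_zero₂₁]
    exact mul_ne_zero det1 det2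
  have hMne : M.det ≠ 0 := by rintro h; simp [h] at hM0
  have hfin : ({t : ℚ | M.det.IsRoot t} ∪
      ⋃ p ∈ (Q1.toFinset : Set (ℕ × Q3)), ⋃ q ∈ (Q2.toFinset : Set (ℕ × Q3)),
        {t : ℚ | 0 < t ∧ scl t w p.2 = q.2}).Finite := by
    refine Set.Finite.union (Polynomial.finite_setOfPred_isRoot hMne) ?_
    refine Set.Finite.biUnion (Finset.finite_toSet _) fun p hp => ?_
    refine Set.Finite.biUnion (Finset.finite_toSet _) fun q _ => ?_
    exact scl_eq_finite hw (c1 p (by simpa using hp))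
  obtain ⟨t, ht, htn⟩ := ((Set.Ioi_infinite (0 : ℚ)).sdiff hfin).nonempty
  have ht0 : t ≠ 0 := ne_of_gt ht
  simp only [Set.mem_union, Set.mem_iUnion, not_or, Set.mem_ofPred_eq, not_exists] at htn
  obtain ⟨hroot, hcoin⟩ := htn
  refine ⟨Q1.map (fun mp => (mp.1, scl t w mp.2)) + Q2, ?_, ?_, ?_, ?_⟩
  · rw [Multiset.map_add, Multiset.map_map, ← a1, ← a2]; rfl
  · rw [Multiset.map_add, Multiset.map_map, Multiset.nodup_add]
    refine ⟨?_, b2, ?_⟩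
    · have : (Q1.map (Prod.snd ∘ fun mp : ℕ × Q3 => (mp.1, scl t w mp.2))) =
        (Q1.map Prod.snd).map (scl t w) := by rw [Multiset.map_map]; rfl
      rw [this]
      exact b1.map (scl_inj ht0 w)
    · rw [Multiset.disjoint_left]
      intro a ha hb
      rw [Multiset.mem_map] at ha hb
      obtain ⟨p, hp, rfl⟩ := ha
      obtain ⟨q, hq, hpq⟩ := hb
      exact hcoin p (by simpa using hp) q (by simpa using hq) ⟨ht, hpq.symm⟩
  · intro mp hmp
    rw [Multiset.mem_add, Multiset.mem_map] at hmp
    rcases hmp with ⟨p, hp, rfl⟩ | hmp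
    · exact tor_scl ht0 w (c1 p hp)
    · exact c2 mp hmp
  · intro c hc
    let e : D1 ⊕ D2 → ℚ := Sum.elim (fun b => c b * t ^ (dot w b - τ)) (fun b => c b)
    have hsplit : ∀ f : Z3 → ℚ, ∑ δ ∈ D, f δ = ∑ b : D1, f b + ∑ b : D2, f b := by
      intro f
      rw [Finset.sum_coe_sort D1 f, Finset.sum_coe_sort D2 f, hD1, hD2,
        Finset.sum_filter_add_sum_filter_not]
    have hdet : (M.map (Polynomial.evalRingHom t)).det ≠ 0 := by
      have e : M.det.eval t = (M.map (Polynomial.evalRingHom t)).det := by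
        rw [← Polynomial.coe_evalRingHom, RingHom.map_det]; rfl
      rw [← e]; exact hroot
    have hmul : (M.map (Polynomial.evalRingHom t)).mulVec e = 0 := by
      funext a
      rcases a with a | a
      · obtain ⟨m, hm, hlt⟩ := hρ1 a
        have h0 := hc (m, scl t w (ρ1 a).1)
          (Multiset.mem_add.2 (Or.inl (Multiset.mem_map.2 ⟨_, hm, rfl⟩))) _ _ _ hlt
        rw [hsplit] at h0
        simp only [chr_scl ht0] at h0
        have h1 : (M.map (Polynomial.evalRingHom t)).mulVec e (Sum.inl a) = t ^ (-τ) *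
            (∑ b : D1, c b * (mon (ρ1 a).2.1 (ρ1 a).2.2.1 (ρ1 a).2.2.2 b *
              (t ^ dot w b * chr (ρ1 a).1 b)) + ∑ b : D2, c b *
              (mon (ρ1 a).2.1 (ρ1 a).2.2.1 (ρ1 a).2.2.2 b * (t ^ dot w b * chr (ρ1 a).1 b))) := by
          simp only [Matrix.mulVec, dotProduct, Fintype.sum_sum_type]
          rw [mul_add, Finset.mul_sum, Finset.mul_sum]
          congr 1
          · refine Finset.sum_congr rfl fun b _ => ?_
            simp only [M, e, Matrix.map_apply, Matrix.fromBlocks_apply₁₁, Matrix.of_apply,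
              Polynomial.coe_evalRingHom, Polynomial.eval_C, Sum.elim_inl, rowf, sub_eq_add_neg, zpow_add₀ ht0]
            ring
          · refine Finset.sum_congr rfl fun b _ => ?_
            have e1 : t ^ (dot w b - τ).toNat = t ^ (dot w b) * t ^ (-τ) := by
              rw [← zpow_add₀ ht0, ← zpow_natCast]
              congr 1
              have := m2 b
              omega
            simp only [M, e, Matrix.map_apply, Matrix.fromBlocks_apply₁₂, Matrix.of_apply,
              Polynomial.coe_evalRingHom, Polynomial.eval_C, Polynomial.eval_mul, Polynomial.eval_pow, Polynomial.eval_X, Sum.elim_inr, rowf, e1]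
            ring
        rw [h1, h0, mul_zero]; rfl
      · obtain ⟨m, hm, hlt⟩ := hρ2 a
        have h0 := hc (m, (ρ2 a).1) (Multiset.mem_add.2 (Or.inr hm)) _ _ _ hlt
        rw [hsplit] at h0
        rw [Pi.zero_apply, ← h0]
        simp only [Matrix.mulVec, dotProduct, Fintype.sum_sum_type]
        congr 1
        · refine Finset.sum_congr rfl fun b _ => ?_
          have e1 : t ^ (τ - dot w b).toNat * t ^ (dot w b - τ) = 1 := by
            rw [← zpow_natCast, ← zpow_add₀ ht0]
            have := m1 b
            rw [Int.toNat_of_nonneg (by omega)]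
            simp
          simp only [M, e, Matrix.map_apply, Matrix.fromBlocks_apply₂₁, Matrix.of_apply,
            Polynomial.coe_evalRingHom, Polynomial.eval_C, Polynomial.eval_mul, Polynomial.eval_pow, Polynomial.eval_X, Sum.elim_inl, rowf]
          linear_combination (c b * (mon (ρ2 a).2.1 (ρ2 a).2.2.1 (ρ2 a).2.2.2 b *
            chr (ρ2 a).1 b)) * e1
        · refine Finset.sum_congr rfl fun b _ => ?_
          simp only [M, e, Matrix.map_apply, Matrix.fromBlocks_apply₂₂, Matrix.of_apply,
            Polynomial.coe_evalRingHom, Polynomial.eval_C, Sum.elim_inr, rowf]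
          ring
    have he := Matrix.eq_zero_of_mulVec_eq_zero hdet hmul
    intro δ hδ
    by_cases hlt : dot w δ < τ
    · have := congrFun he (Sum.inl ⟨δ, Finset.mem_filter.2 ⟨hδ, hlt⟩⟩)
      simp only [e, Sum.elim_inl, Pi.zero_apply] at this
      exact (mul_eq_zero.1 this).resolve_right (zpow_ne_zero _ ht0)
    · exact congrFun he (Sum.inr ⟨δ, Finset.mem_filter.2 ⟨hδ, hlt⟩⟩)

theorem Inj.mono_add {D : Finset Z3} {ms ms' : Multiset ℕ} (h : Inj D ms)  (hle : ms ≤ ms') :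
    Inj D ms' := by
  obtain ⟨t, rfl⟩ := Multiset.le_iff_exists_add.1 hle
  clear hle
  induction t using Multiset.induction with
  | empty => simpa using h
  | cons a t ih =>
    obtain ⟨Q, a1, a2, a3, a4⟩ := ih
    obtain ⟨x, hx⟩ : ∃ x : ℚ, x ∉ insert 0 ((Q.map fun mp => mp.2.1).toFinset) :=
      Infinite.exists_notMem_finset _
    simp only [Finset.mem_insert, Multiset.mem_toFinset, Multiset.mem_map, not_or,
      not_exists, not_and] at hx
    refine ⟨(a, (x, 1, 1)) ::ₘ Q, ?_, ?_, ?_, ?_⟩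
    · simp [a1]
    · simp only [Multiset.map_cons, Multiset.nodup_cons]
      refine ⟨?_, a2⟩
      rw [Multiset.mem_map]
      rintro ⟨p, hp, hpx⟩
      exact hx.2 p hp (by rw [hpx])
    · intro mp hmp
      rw [Multiset.mem_cons] at hmp
      rcases hmp with rfl | hmp
      · exact ⟨hx.1, one_ne_zero, one_ne_zero⟩
      · exact a3 mp hmp
    · intro c hc
      exact a4 c fun mp hmp => hc mp (Multiset.mem_cons_of_mem hmp)


/-! ## A fast rank checker modulo `65521`

Vectors of residues are packed into natural numbers with 48-bit slots. -/

def force (x : ℕ) (k : ℕ → Bool) : Bool := Nat.rec (k 0) (fun n _ => k (Nat.succ n)) x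

theorem force_eq (x : ℕ) (k : ℕ → Bool) : force x k = k x := by cases x <;> rfl

/-- The slot size `2 ^ 48`. -/
def BB : ℕ := 281474976710656

def mono4 (a b c : ℕ) : ℕ :=
  1 + BB*(a + BB*(b + BB*(c + BB*(a*a + BB*(a*b + BB*(a*c + BB*(b*b + BB*(b*c + BB*(c*c +
   BB*(a*a*a + BB*(a*a*b + BB*(a*a*c + BB*(a*b*b + BB*(a*b*c + BB*(a*c*c + BB*(b*b*b +
   BB*(b*b*c + BB*(b*c*c + BB*(c*c*c)))))))))))))))))))

def monExp : List (ℕ × ℕ × ℕ) :=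
  [(0,0,0),(1,0,0),(0,1,0),(0,0,1),(2,0,0),(1,1,0),(1,0,1),(0,2,0),(0,1,1),(0,0,2),
   (3,0,0),(2,1,0),(2,0,1),(1,2,0),(1,1,1),(1,0,2),(0,3,0),(0,2,1),(0,1,2),(0,0,3)]

def monN (δ e : ℕ × ℕ × ℕ) : ℕ := δ.1 ^ e.1 * δ.2.1 ^ e.2.1 * δ.2.2 ^ e.2.2

theorem mono4_eq (a b c : ℕ) : mono4 a b c = Nat.ofDigits BB (monExp.map (monN (a, b, c))) := by
  unfold mono4
  generalize BB = q
  simp only [monExp, List.map, monN, Nat.ofDigits_cons, Nat.ofDigits_nil]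
  simp only [pow_zero, one_mul, mul_one, pow_succ, mul_zero, add_zero, mul_assoc]

/-- A point with a multiplicity: number of slots, then the coordinates. -/
abbrev MP := ℕ × ℕ × ℕ × ℕ

def chrN (p δ : ℕ × ℕ × ℕ) : ℕ := (p.1 ^ δ.1 * p.2.1 ^ δ.2.1 * p.2.2 ^ δ.2.2) % 65521

noncomputable def vecGo (M a b c : ℕ) (l : List MP) : ℕ :=
  List.rec 0 (fun p _ r => Nat.add (Nat.mul (Nat.mod M p.1)
    (Nat.mod (Nat.mul (Nat.mul (Nat.pow p.2.1 a) (Nat.pow p.2.2.1 b)) (Nat.pow p.2.2.2 c)) 65521))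
    (Nat.mul p.1 r)) l

noncomputable def vecs (pts : List MP) (l : List (ℕ × ℕ × ℕ)) : (List ℕ → Bool) → Bool :=
  List.rec (fun k => k []) (fun p _ r k => force (mono4 p.1 p.2.1 p.2.2) fun M =>
    force (vecGo M p.1 p.2.1 p.2.2 pts) fun v => r fun l => k (v :: l)) l

noncomputable def powL (x : ℕ) (l : List ℕ) : ℕ → (ℕ → Bool) → Bool :=
  List.rec (fun a k => k a) (fun b _ r a k =>
    force (Nat.mod (Nat.mul (Nat.mul a a) (Nat.pow x b)) 65521) fun a' => r a' k) l

noncomputable def invK (x : ℕ) (k : ℕ → Bool) : Bool :=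
  powL x [1,1,1,1,1,1,1,1,1,1,1,0,1,1,1,1] 1 k

def redP (ones hi v : ℕ) : ℕ :=
  Nat.sub v (Nat.mul 65521 (Nat.shiftRight (Nat.land (Nat.add v (Nat.mul 15 ones)) hi) 16))

def normK (ones hi v : ℕ) (k : ℕ → Bool) : Bool :=
  force (redP ones hi v) fun v => force (redP ones hi v) fun v =>
    force (redP ones hi v) fun v => force (redP ones hi v) k

noncomputable def findT (u : ℕ) (l : List ℕ) : ℕ → (ℕ → Bool) → Bool :=
  List.rec (fun s k => k s) (fun b _ r s k =>
    cond (Nat.ble (Nat.pow 2 (Nat.add s b)) u) (force (Nat.add s b) fun s => r s k) (r s k)) l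

def upd (s i u w : ℕ) : ℕ :=
  Nat.add w (Nat.mul u (Nat.sub 65521
    (Nat.mod (Nat.mul (Nat.mod (Nat.shiftRight w s) 281474976710656) i) 65521)))

noncomputable def mapK (s i u : ℕ) (l : List ℕ) : (List ℕ → Bool) → Bool :=
  List.rec (fun k => k [])
    (fun w _ r k => force (upd s i u w) fun x => r fun l => k (x :: l)) l

noncomputable def elimK (ones hi : ℕ) (f : ℕ) : List ℕ → Bool :=
  Nat.rec (fun l => List.rec true (fun _ _ _ => false) l)
    (fun _ r l => List.rec true (fun v vs _ => normK ones hi v fun u =>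
      findT u [3072,1536,768,384,192,96,48] 0 fun s =>
      force (Nat.mod (Nat.shiftRight u s) 281474976710656) fun e =>
      invK e fun i => cond (Nat.beq (Nat.mod (Nat.mul e i) 65521) 1) (mapK s i u vs r) false) l) f

theorem normK_eq (ones hi v : ℕ) (k : ℕ → Bool) : normK ones hi v k =
    k (redP ones hi (redP ones hi (redP ones hi (redP ones hi v)))) := by
  simp only [normK, force_eq]

theorem powL_eq (x : ℕ) (l : List ℕ) (a : ℕ) (k : ℕ → Bool) : ∃ i, powL x l a k = k i := by
  induction l generalizing a with
  | nil => exact ⟨a, rfl⟩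
  | cons b l ih =>
    obtain ⟨i, hi⟩ := ih (Nat.mod (Nat.mul (Nat.mul a a) (Nat.pow x b)) 65521)
    exact ⟨i, by rw [← hi, ← force_eq _ (fun a' => powL x l a' k)]; rfl⟩

theorem findT_eq (u : ℕ) (l : List ℕ) (hl : ∀ b ∈ l, 48 ∣ b) (s : ℕ) (hs : 48 ∣ s)
    (k : ℕ → Bool) : ∃ j, findT u l s k = k (48 * j) := by
  induction l generalizing s with
  | nil => obtain ⟨j, rfl⟩ := hs; exact ⟨j, rfl⟩
  | cons b l ih =>
    have e : findT u (b :: l) s k = cond (Nat.ble (Nat.pow 2 (Nat.add s b)) u)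
      (force (Nat.add s b) fun s => findT u l s k) (findT u l s k) := rfl
    rw [e, force_eq]
    have h1 := ih (fun b hb => hl b (List.mem_cons_of_mem _ hb))
    cases Nat.ble (Nat.pow 2 (Nat.add s b)) u
    · exact h1 s hs
    · exact h1 (s + b) (dvd_add hs (hl b List.mem_cons_self))

theorem mapK_eq (s i u : ℕ) (l : List ℕ) (k : List ℕ → Bool) :
    mapK s i u l k = k (l.map (upd s i u)) := by
  induction l generalizing k with
  | nil => rfl
  | cons w l ih =>
    have e : mapK s i u (w :: l) k =
      force (upd s i u w) fun x => mapK s i u l fun l => k (x :: l) := rfl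
    rw [e, force_eq, ih]; rfl

theorem elimK_cons {ones hi f v : ℕ} {vs : List ℕ} (h : elimK ones hi (f + 1) (v :: vs) = true) :
    ∃ j i : ℕ, let u := redP ones hi (redP ones hi (redP ones hi (redP ones hi v)))
      ((u >>> (48 * j)) % 281474976710656) * i % 65521 = 1 ∧
      elimK ones hi f (vs.map (upd (48 * j) i u)) = true := by
  have e : elimK ones hi (f + 1) (v :: vs) = normK ones hi v fun u =>
      findT u [3072,1536,768,384,192,96,48] 0 fun s =>
      force (Nat.mod (Nat.shiftRight u s) 281474976710656) fun e =>
      invK e fun i => cond (Nat.beq (Nat.mod (Nat.mul e i) 65521) 1)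
        (mapK s i u vs (elimK ones hi f)) false := rfl
  rw [e, normK_eq] at h
  generalize redP ones hi (redP ones hi (redP ones hi (redP ones hi v))) = u at h ⊢
  obtain ⟨j, hj⟩ := findT_eq u [3072,1536,768,384,192,96,48] (by decide) 0 (by decide) (fun s =>
      force (Nat.mod (Nat.shiftRight u s) 281474976710656) fun e =>
      invK e fun i => cond (Nat.beq (Nat.mod (Nat.mul e i) 65521) 1)
        (mapK s i u vs (elimK ones hi f)) false)
  rw [hj, force_eq] at h
  obtain ⟨i, hi'⟩ := powL_eq (Nat.mod (Nat.shiftRight u (48 * j)) 281474976710656)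
    [1,1,1,1,1,1,1,1,1,1,1,0,1,1,1,1] 1 (fun i => cond (Nat.beq (Nat.mod (Nat.mul
      (Nat.mod (Nat.shiftRight u (48 * j)) 281474976710656) i) 65521) 1)
        (mapK (48 * j) i u vs (elimK ones hi f)) false)
  rw [invK, hi'] at h
  refine ⟨j, i, ?_⟩
  cases hb : Nat.beq (Nat.mod (Nat.mul
      (Nat.mod (Nat.shiftRight u (48 * j)) 281474976710656) i) 65521) 1
  · rw [hb] at h; cases h
  · rw [hb, cond_true, mapK_eq] at h
    exact ⟨Nat.eq_of_beq_eq_true hb, h⟩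

/-! ### Slot semantics -/

def val : ℕ → (ℕ → ℕ) → ℕ
  | 0, _ => 0
  | n + 1, l => l 0 + BB * val n (fun j => l (j + 1))

theorem val_add (n : ℕ) (l m : ℕ → ℕ) : val n (fun j => l j + m j) = val n l + val n m := by
  induction n generalizing l m with
  | zero => rfl
  | succ n ih => simp only [val, ih]; ring

theorem val_mul (n : ℕ) (t : ℕ) (l : ℕ → ℕ) : val n (fun j => t * l j) = t * val n l := by
  induction n generalizing l with
  | zero => rfl
  | succ n ih => simp only [val, ih]; ring

theorem val_congr {n : ℕ} {l m : ℕ → ℕ} (h : ∀ j < n, l j = m j) : val n l = val n m := by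
  induction n generalizing l m with
  | zero => rfl
  | succ n ih =>
    simp only [val]
    rw [h 0 (by omega), ih fun j hj => h (j + 1) (by omega)]

theorem val_slot {n : ℕ} {l : ℕ → ℕ} (h : ∀ j < n, l j < BB) (j : ℕ) :
    (val n l >>> (48 * j)) % BB = if j < n then l j else 0 := by
  induction n generalizing l j with
  | zero => simp [val]
  | succ n ih =>
    have h0 := h 0 (by omega)
    cases j with
    | zero =>
      simp only [val, Nat.mul_zero, Nat.shiftRight_zero]
      rw [Nat.add_mul_mod_self_left, Nat.mod_eq_of_lt h0]; simp
    | succ j =>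
      have e : val (n + 1) l >>> (48 * (j + 1)) = val n (fun j => l (j + 1)) >>> (48 * j) := by
        rw [show 48 * (j + 1) = 48 + 48 * j by ring, Nat.shiftRight_add]
        congr 1
        rw [Nat.shiftRight_eq_div_pow]
        show (l 0 + BB * val n (fun j => l (j + 1))) / BB = _
        rw [Nat.add_mul_div_left _ _ (by decide), Nat.div_eq_of_lt h0, zero_add]
      rw [e, ih fun j hj => h (j + 1) (by omega)]
      simp

theorem land_slot {a b x y : ℕ} (ha : a < BB) (hb : b < BB) :
    (a + BB * x) &&& (b + BB * y) = (a &&& b) + BB * (x &&& y) := by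
  have hab : a &&& b < 2 ^ 48 := lt_of_le_of_lt Nat.and_le_left ha
  apply Nat.eq_of_testBit_eq
  intro i
  have e : BB = 2 ^ 48 := by decide
  rw [e] at *
  rw [add_comm a, add_comm b, add_comm (a &&& b), Nat.testBit_and, Nat.testBit_two_pow_mul_add _ ha,
    Nat.testBit_two_pow_mul_add _ hb, Nat.testBit_two_pow_mul_add _ hab]
  split <;> simp

theorem val_land {n : ℕ} {l m : ℕ → ℕ} (hl : ∀ j < n, l j < BB) (hm : ∀ j < n, m j < BB) :
    val n l &&& val n m = val n (fun j => l j &&& m j) := by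
  induction n generalizing l m with
  | zero => simp [val]
  | succ n ih =>
    simp only [val]
    rw [land_slot (hl 0 (by omega)) (hm 0 (by omega)),
      ih (fun j hj => hl (j + 1) (by omega)) (fun j hj => hm (j + 1) (by omega))]

def redS (a : ℕ) : ℕ := a - 65521 * ((a + 15) / 65536)

theorem redS_le (a : ℕ) : redS a ≤ a := by unfold redS; omega

theorem redS_add (a : ℕ) : redS a + 65521 * ((a + 15) / 65536) = a := by unfold redS; omega

theorem redS_cast (a : ℕ) : ((redS a : ℕ) : ZMod 65521) = a := by
  conv_rhs => rw [← redS_add a]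
  push_cast
  rw [show (65521 : ZMod 65521) = 0 from by exact_mod_cast ZMod.natCast_self 65521]
  simp

theorem land_hi {a : ℕ} (ha : a < BB) : a &&& 281474976645120 = 65536 * (a / 65536) := by
  have e1 : a = 65536 * (a / 65536) + a % 65536 := (Nat.div_add_mod _ _).symm
  have e2 : (281474976645120 : ℕ) = 2 ^ 16 * (2 ^ 32 - 1) + 0 := by norm_num
  rw [e2]
  conv_lhs => rw [e1]
  have h1 : a % 65536 < 2 ^ 16 := Nat.mod_lt _ (by norm_num)
  apply Nat.eq_of_testBit_eq
  intro i
  rw [Nat.testBit_and, show 65536 = 2 ^ 16 by norm_num] at *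
  rw [Nat.testBit_two_pow_mul_add _ h1, Nat.testBit_two_pow_mul_add _ (by norm_num)]
  rw [show 2 ^ 16 * (a / 2 ^ 16) = 2 ^ 16 * (a / 2 ^ 16) + 0 by ring,
    Nat.testBit_two_pow_mul_add _ (by norm_num)]
  split
  · simp
  · rw [Nat.testBit_two_pow_sub_one]
    by_cases h : i - 16 < 32
    · simp [h]
    · have : a / 2 ^ 16 < 2 ^ (i - 16) := by
        calc a / 2 ^ 16 < 2 ^ 32 := by
              rw [Nat.div_lt_iff_lt_mul (by norm_num)]; exact ha
          _ ≤ _ := Nat.pow_le_pow_right (by norm_num) (by omega)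
      rw [Nat.testBit_lt_two_pow this]; simp

theorem redP_val {n : ℕ} {l : ℕ → ℕ} (h : ∀ j < n, l j ≤ 2 ^ 46) :
    redP (val n fun _ => 1) (val n fun _ => 281474976645120) (val n l) =
      val n (fun j => redS (l j)) := by
  have h1 : val n l + 15 * val n (fun _ => 1) = val n (fun j => l j + 15) := by
    rw [val_add, ← val_mul]
  have h2 : val n (fun j => l j + 15) &&& val n (fun _ => 281474976645120) =
      65536 * val n (fun j => (l j + 15) / 65536) := by
    have hb : ∀ j < n, l j + 15 < BB := fun j hj => by
      have := h j hj; unfold BB; omega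
    rw [val_land hb (fun _ _ => by decide), ← val_mul]
    exact val_congr fun j hj => land_hi (hb j hj)
  show val n l - 65521 * (((val n l + 15 * val n (fun _ => 1)) &&&
    val n (fun _ => 281474976645120)) >>> 16) = _
  rw [h1, h2, Nat.shiftRight_eq_div_pow, show 2 ^ 16 = 65536 by norm_num,
    Nat.mul_div_cancel_left _ (by norm_num), ← val_mul]
  conv_lhs => rw [← val_congr (l := fun j => redS (l j) + 65521 * ((l j + 15) / 65536))
    (fun j _ => redS_add (l j)), val_add]
  rw [Nat.add_sub_cancel]

def red4 (a : ℕ) : ℕ := redS (redS (redS (redS a)))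

theorem red4_le {a : ℕ} (h : a ≤ 2 ^ 46) : red4 a ≤ 2 ^ 22 := by
  have h1 : redS a ≤ 2 ^ 34 := by unfold redS; omega
  have h2 : redS (redS a) ≤ 2 ^ 22 := by
    generalize redS a = b at *
    unfold redS; omega
  exact (redS_le _).trans ((redS_le _).trans h2)

theorem red4_cast (a : ℕ) : ((red4 a : ℕ) : ZMod 65521) = a := by simp only [red4, redS_cast]

theorem redP4_val {n : ℕ} {l : ℕ → ℕ} (h : ∀ j < n, l j ≤ 2 ^ 46) :
    redP (val n fun _ => 1) (val n fun _ => 281474976645120)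
     (redP (val n fun _ => 1) (val n fun _ => 281474976645120)
     (redP (val n fun _ => 1) (val n fun _ => 281474976645120)
     (redP (val n fun _ => 1) (val n fun _ => 281474976645120) (val n l)))) =
      val n (fun j => red4 (l j)) := by
  have h1 : ∀ j < n, redS (l j) ≤ 2 ^ 46 := fun j hj => (redS_le _).trans (h j hj)
  have h2 : ∀ j < n, redS (redS (l j)) ≤ 2 ^ 46 := fun j hj => (redS_le _).trans (h1 j hj)
  have h3 : ∀ j < n, redS (redS (redS (l j))) ≤ 2 ^ 46 := fun j hj => (redS_le _).trans (h2 j hj)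
  rw [redP_val h, redP_val h1, redP_val h2, redP_val h3]
  rfl

/-! ### Independence modulo the prime -/

def comb : List (ZMod 65521) → List (ℕ → ℕ) → ℕ → ZMod 65521
  | c :: cs, l :: ls, j => c * (l j : ZMod 65521) + comb cs ls j
  | _, _, _ => 0

def IndF (n : ℕ) (ls : List (ℕ → ℕ)) : Prop :=
  ∀ cs : List (ZMod 65521), cs.length = ls.length → (∀ j < n, comb cs ls j = 0) →
    ∀ c ∈ cs, c = 0

def tcoef (l : ℕ → ℕ) (j i : ℕ) : ℕ := 65521 - (l j * i) % 65521

theorem tcoef_le (l : ℕ → ℕ) (j i : ℕ) : tcoef l j i ≤ 65521 := Nat.sub_le _ _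

theorem tcoef_cast (l : ℕ → ℕ) (j i : ℕ) :
    ((tcoef l j i : ℕ) : ZMod 65521) = -((l j : ZMod 65521) * i) := by
  have h : tcoef l j i + (l j * i) % 65521 = 65521 := by
    have := Nat.mod_lt (l j * i) (show 65521 > 0 by norm_num)
    unfold tcoef; omega
  have h2 := congrArg (Nat.cast : ℕ → ZMod 65521) h
  push_cast [ZMod.natCast_mod] at h2
  rw [show (65521 : ZMod 65521) = 0 from by exact_mod_cast ZMod.natCast_self 65521] at h2
  linear_combination h2

def tcsum : List (ZMod 65521) → List (ℕ → ℕ) → ℕ → ℕ → ZMod 65521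
  | c :: cs, l :: ls, j, i => c * (tcoef l j i : ZMod 65521) + tcsum cs ls j i
  | _, _, _, _ => 0

theorem comb_upd (u : ℕ → ℕ) (j0 i : ℕ) (cs : List (ZMod 65521)) (ls : List (ℕ → ℕ)) (j : ℕ) :
    comb cs (ls.map fun l j => l j + u j * tcoef l j0 i) j =
      comb cs ls j + tcsum cs ls j0 i * (u j : ZMod 65521) := by
  induction ls generalizing cs with
  | nil => cases cs <;> simp [comb, tcsum]
  | cons l ls ih =>
    cases cs with
    | nil => simp [comb, tcsum]
    | cons c cs => simp only [List.map, comb, tcsum, ih]; push_cast; ring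

theorem comb_upd_zero (u : ℕ → ℕ) (j0 i : ℕ) (hu : (u j0 : ZMod 65521) * i = 1)
    (cs : List (ZMod 65521)) (ls : List (ℕ → ℕ)) :
    comb cs (ls.map fun l j => l j + u j * tcoef l j0 i) j0 = 0 := by
  induction ls generalizing cs with
  | nil => cases cs <;> simp [comb]
  | cons l ls ih =>
    cases cs with
    | nil => simp [comb]
    | cons c cs =>
      simp only [List.map, comb, ih]; push_cast
      rw [tcoef_cast]
      linear_combination (-c * (l j0 : ZMod 65521)) * hu

theorem IndF_step {n j0 i : ℕ} (hj : j0 < n) {v u : ℕ → ℕ} {ls : List (ℕ → ℕ)}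
    (huv : ∀ j, (u j : ZMod 65521) = v j) (hu : (u j0 : ZMod 65521) * i = 1)
    (h : IndF n (ls.map fun l j => l j + u j * tcoef l j0 i)) : IndF n (v :: ls) := by
  intro cs hlen hc
  cases cs with
  | nil => simp
  | cons c cs =>
    simp only [List.length_cons, add_left_inj] at hlen
    simp only [comb, ← huv] at hc
    have h0 := comb_upd_zero u j0 i hu cs ls
    rw [comb_upd] at h0
    have h1 : tcsum cs ls j0 i = c := by
      linear_combination (i : ZMod 65521) * h0 - (i : ZMod 65521) * hc j0 hj +
        (c - tcsum cs ls j0 i) * hu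
    have h2 := h cs (by simpa using hlen) (fun j hj => by
      rw [comb_upd, h1, ← hc j hj]; ring)
    have h3 : tcsum cs ls j0 i = 0 := by
      clear hlen hc h0 h1 h
      induction ls generalizing cs with
      | nil => cases cs <;> rfl
      | cons l ls ih =>
        cases cs with
        | nil => rfl
        | cons c cs =>
          simp only [tcsum]
          rw [h2 c List.mem_cons_self, ih cs fun c hc => h2 c (List.mem_cons_of_mem _ hc)]
          ring
    intro c' hc'
    rcases List.mem_cons.1 hc' with rfl | hc'
    · rw [← h1, h3]
    · exact h2 c' hc'

theorem elimK_sound (n f : ℕ) (hf : f ≤ 127) (ls : List (ℕ → ℕ))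
    (hb : ∀ l ∈ ls, ∀ j < n, l j ≤ 2 ^ 46 - f * 2 ^ 38)
    (h : elimK (val n fun _ => 1) (val n fun _ => 281474976645120) f (ls.map (val n)) = true) :
    IndF n ls := by
  induction f generalizing ls with
  | zero =>
    cases ls with
    | nil => intro cs hcs; simp at hcs; simp [hcs]
    | cons l ls => cases h
  | succ f ih =>
    cases ls with
    | nil => intro cs hcs; simp at hcs; simp [hcs]
    | cons v ls =>
      obtain ⟨j, i, h1, h2⟩ := elimK_cons h
      have hv : ∀ j < n, v j ≤ 2 ^ 46 := fun j hj =>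
        (hb v List.mem_cons_self j hj).trans (Nat.sub_le _ _)
      have e := redP4_val hv
      rw [e] at h1 h2
      have hs : ∀ j < n, red4 (v j) < BB := fun j hj =>
        lt_of_le_of_lt (red4_le (hv j hj)) (by decide)
      have h3 := val_slot hs j
      rw [BB] at h3
      rw [h3] at h1
      have hj : j < n := by
        by_contra hj
        rw [if_neg hj] at h1
        simp at h1
      rw [if_pos hj] at h1
      refine IndF_step (u := fun j => red4 (v j)) (i := i) hj (fun j => red4_cast _) ?_ ?_
      · have := congrArg (Nat.cast : ℕ → ZMod 65521) h1
        push_cast [ZMod.natCast_mod] at this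
        exact this
      · apply ih (by omega)
        · intro l hl j' hj'
          rw [List.mem_map] at hl
          obtain ⟨l, hl, rfl⟩ := hl
          have a1 := hb l (List.mem_cons_of_mem _ hl) j' hj'
          have a2 := red4_le (hv j' hj')
          have a3 := tcoef_le l j i
          have a4 : red4 (v j') * tcoef l j i ≤ 2 ^ 22 * 65521 := Nat.mul_le_mul a2 a3
          simp only
          omega
        · rw [List.map_map] at h2 ⊢
          rw [← h2]
          congr 1
          apply List.map_congr_left
          intro l hl
          have a1 : ∀ j < n, l j < BB := fun j hj => by
            have := hb l (List.mem_cons_of_mem _ hl) j hj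
            unfold BB; omega
          show val n (fun j' => l j' + red4 (v j') * tcoef l j i) =
            val n l + val n (fun j => red4 (v j)) * (65521 -
              (((val n l >>> (48 * j)) % 281474976710656) * i) % 65521)
          have a2 := val_slot a1 j
          rw [BB, if_pos hj] at a2
          rw [a2, val_add]
          congr 1
          rw [mul_comm (val n _), ← val_mul]
          exact val_congr fun j' _ => mul_comm _ _


/-! ### Soundness of the rank check -/

/-- Fixed pseudo-random points. -/
def ptsP : List (ℕ × ℕ × ℕ) :=
  [(417,826,618),(698,533,1001),(422,52,342),(521,904,363),(816,870,144),
   (804,422,42),(551,367,546),(41,917,725),(287,799,812),(328,177,145),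
   (128,349,9),(622,810,743),(334,368,359),(277,914,379),(700,822,153),
   (668,3,510),(130,778,433),(428,317,411),(17,467,900),(215,924,228),
   (43,256,76),(396,887,881),(672,122,762),(117,705,373),(337,680,694),
   (581,185,76),(827,131,984),(523,842,641),(821,440,291),(497,911,869),
   (796,130,776),(900,283,651),(733,231,484),(866,296,395),(882,615,908),
   (633,532,991),(173,891,36),(358,665,965),(766,894,108),(635,481,472)]

def nsl (m : ℕ) : ℕ := [0, 1, 4, 10, 20].getD m 0

def msList (x y z u : ℕ) : List ℕ :=
  List.replicate x 4 ++ (List.replicate y 3 ++ (List.replicate z 2 ++ List.replicate u 1))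

def toMP (q : ℕ × ℕ × ℕ × ℕ) : MP := (BB ^ nsl q.1, q.2.1, q.2.2.1, q.2.2.2)

noncomputable def mpK (l : List (ℕ × ℕ × ℕ × ℕ)) : (List MP → Bool) → Bool :=
  List.rec (fun k => k []) (fun q _ r k => force (BB ^ nsl q.1) fun s => force q.2.1 fun a =>
    force q.2.2.1 fun b => force q.2.2.2 fun c => r fun l => k ((s, a, b, c) :: l)) l

theorem mpK_eq (l : List (ℕ × ℕ × ℕ × ℕ)) (k : List MP → Bool) : mpK l k = k (l.map toMP) := by
  induction l generalizing k with
  | nil => rfl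
  | cons w l ih =>
    have e : mpK (w :: l) k = force (BB ^ nsl w.1) fun s => force w.2.1 fun a =>
      force w.2.2.1 fun b => force w.2.2.2 fun c => mpK l fun l => k ((s, a, b, c) :: l) := rfl
    rw [e]; simp only [force_eq, ih]; rfl

noncomputable def rankCheck (L : List (ℕ × ℕ × ℕ)) (x y z u : ℕ) : Bool :=
  mpK ((msList x y z u).zip ptsP) fun pts =>
  force ((BB ^ (20 * x + 10 * y + 4 * z + u) - 1) / (BB - 1)) fun ones =>
  force (281474976645120 * ones) fun hi =>
  vecs pts L fun vs => elimK ones hi 127 vs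

def vecOf (pts : List MP) (δ : ℕ × ℕ × ℕ) : ℕ :=
  (pts.foldr (fun p r => (mono4 δ.1 δ.2.1 δ.2.2 % p.1) * chrN p.2 δ + p.1 * r) 0)

theorem vecs_eq (pts : List MP) (l : List (ℕ × ℕ × ℕ)) (k : List ℕ → Bool) :
    vecs pts l k = k (l.map (vecOf pts)) := by
  induction l generalizing k with
  | nil => rfl
  | cons w l ih =>
    have e : vecs pts (w :: l) k = force (mono4 w.1 w.2.1 w.2.2) fun M =>
      force (vecGo M w.1 w.2.1 w.2.2 pts) fun v => vecs pts l fun l => k (v :: l) := rfl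
    have e2 : ∀ M, vecGo M w.1 w.2.1 w.2.2 pts =
        pts.foldr (fun p r => (M % p.1) * chrN p.2 w + p.1 * r) 0 := by
      intro M
      clear e ih
      induction pts with
      | nil => rfl
      | cons p pts ih' =>
        rw [List.foldr_cons, ← ih']; rfl
    rw [e]; simp only [force_eq, ih, e2]; rfl

def cols (Q : List (ℕ × ℕ × ℕ × ℕ)) : List ((ℕ × ℕ × ℕ) × (ℕ × ℕ × ℕ)) :=
  Q.flatMap fun q => (monExp.take (nsl q.1)).map fun e => (q.2, e)

def entry (δ : ℕ × ℕ × ℕ) (pe : (ℕ × ℕ × ℕ) × (ℕ × ℕ × ℕ)) : ℕ := monN δ pe.2 * chrN pe.1 δ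

theorem monExp_deg : ∀ e ∈ monExp, e.1 + e.2.1 + e.2.2 ≤ 3 := by decide

theorem monN_lt {δ e : ℕ × ℕ × ℕ} (hδ : δ.1 < 32 ∧ δ.2.1 < 32 ∧ δ.2.2 < 32) (he : e ∈ monExp) :
    monN δ e ≤ 2 ^ 15 := by
  have h := monExp_deg e he
  unfold monN
  calc δ.1 ^ e.1 * δ.2.1 ^ e.2.1 * δ.2.2 ^ e.2.2
      ≤ 32 ^ e.1 * 32 ^ e.2.1 * 32 ^ e.2.2 := by
        gcongr <;> omega
    _ = 32 ^ (e.1 + e.2.1 + e.2.2) := by rw [pow_add, pow_add]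
    _ ≤ 32 ^ 3 := Nat.pow_le_pow_right (by norm_num) h
    _ = 2 ^ 15 := by norm_num

theorem nsl_le (m : ℕ) : nsl m ≤ 20 := by
  unfold nsl
  rcases m with _ | _ | _ | _ | _ | m <;> simp

theorem ofDigits_mul (l : List ℕ) (t : ℕ) :
    Nat.ofDigits BB l * t = Nat.ofDigits BB (l.map (· * t)) := by
  induction l with
  | nil => simp
  | cons a l ih => simp only [List.map, Nat.ofDigits_cons, ← ih]; ring

theorem vecOf_eq (Q : List (ℕ × ℕ × ℕ × ℕ)) {δ : ℕ × ℕ × ℕ}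
    (hδ : δ.1 < 32 ∧ δ.2.1 < 32 ∧ δ.2.2 < 32) :
    vecOf (Q.map toMP) δ = Nat.ofDigits BB ((cols Q).map (entry δ)) := by
  induction Q with
  | nil => rfl
  | cons q Q ih =>
    have h1 : vecOf ((q :: Q).map toMP) δ = (mono4 δ.1 δ.2.1 δ.2.2 % BB ^ nsl q.1) *
      chrN q.2 δ + BB ^ nsl q.1 * vecOf (Q.map toMP) δ := rfl
    have h2 : (cols (q :: Q)).map (entry δ) =
        (monExp.take (nsl q.1)).map (fun e => monN δ e * chrN q.2 δ) ++
          (cols Q).map (entry δ) := by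
      simp only [cols, List.flatMap_cons, List.map_append, List.map_map]
      rfl
    have hlen : (monExp.take (nsl q.1)).length = nsl q.1 := by
      rw [List.length_take]
      have := nsl_le q.1
      have : monExp.length = 20 := rfl
      omega
    rw [h1, h2, Nat.ofDigits_append, ih, List.length_map, hlen, mono4_eq]
    congr 1
    have h3 : monExp.map (monN (δ.1, δ.2.1, δ.2.2)) =
        (monExp.take (nsl q.1)).map (monN δ) ++ (monExp.drop (nsl q.1)).map (monN δ) := by
      rw [← List.map_append, List.take_append_drop]
    rw [h3, Nat.ofDigits_append, List.length_map, hlen, Nat.add_mul_mod_self_left,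
      Nat.mod_eq_of_lt, ofDigits_mul, List.map_map]
    · rfl
    · have := Nat.ofDigits_lt_base_pow_length (b := BB) (l := (monExp.take (nsl q.1)).map (monN δ))
        (by decide) (by
          intro x hx
          rw [List.mem_map] at hx
          obtain ⟨e, he, rfl⟩ := hx
          exact lt_of_le_of_lt (monN_lt hδ (List.mem_of_mem_take he)) (by decide))
      rwa [List.length_map, hlen] at this

theorem val_getD (l : List ℕ) : val l.length (fun j => l.getD j 0) = Nat.ofDigits BB l := by
  induction l with
  | nil => rfl
  | cons a l ih =>
    rw [Nat.ofDigits_cons, ← ih]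
    simp [val]

theorem cols_length (x y z u : ℕ) (h : x + y + z + u ≤ 40) :
    (cols ((msList x y z u).zip ptsP)).length = 20 * x + 10 * y + 4 * z + u := by
  have h1 : ∀ Q : List (ℕ × ℕ × ℕ × ℕ), (cols Q).length = ((Q.map Prod.fst).map nsl).sum := by
    intro Q
    induction Q with
    | nil => rfl
    | cons q Q ih =>
      simp only [cols, List.flatMap_cons, List.length_append, List.length_map, List.map_cons,
        List.sum_cons]
      rw [← ih, List.length_take]
      have := nsl_le q.1
      have : monExp.length = 20 := rfl
      simp only [cols]
      omega
  have hl : ptsP.length = 40 := by decide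
  rw [h1, List.map_fst_zip (by simp [msList, hl]; omega)]
  simp [msList, nsl]
  omega

theorem val_ones (n : ℕ) : val n (fun _ => 1) = (BB ^ n - 1) / (BB - 1) := by
  have h : val n (fun _ => 1) * (BB - 1) + 1 = BB ^ n := by
    induction n with
    | zero => rfl
    | succ n ih =>
      rw [pow_succ, ← ih]
      simp only [val]
      generalize val n (fun _ => 1) = t
      have : BB = (BB - 1) + 1 := by decide
      generalize BB - 1 = b at *
      rw [this]; ring
  rw [← h, Nat.add_sub_cancel, Nat.mul_div_cancel _ (by decide)]

theorem val_hi (n : ℕ) : val n (fun _ => 281474976645120) =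
    281474976645120 * ((BB ^ n - 1) / (BB - 1)) := by
  rw [← val_ones, ← val_mul]

def digs (Q : List (ℕ × ℕ × ℕ × ℕ)) (δ : ℕ × ℕ × ℕ) (j : ℕ) : ℕ :=
  ((cols Q).map (entry δ)).getD j 0

theorem rankCheck_IndF {L : List (ℕ × ℕ × ℕ)} {x y z u : ℕ}
    (hb : ∀ δ ∈ L, δ.1 < 32 ∧ δ.2.1 < 32 ∧ δ.2.2 < 32) (hk : x + y + z + u ≤ 40)
    (h : rankCheck L x y z u = true) :
    IndF (cols ((msList x y z u).zip ptsP)).length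
      (L.map (digs ((msList x y z u).zip ptsP))) := by
  rw [rankCheck, mpK_eq] at h
  simp only [force_eq, vecs_eq] at h
  set Q := (msList x y z u).zip ptsP with hQ
  rw [← val_hi, ← val_ones, ← cols_length x y z u hk, ← hQ] at h
  have e : ∀ δ ∈ L, vecOf (Q.map toMP) δ = val (cols Q).length (digs Q δ) := by
    intro δ hδ
    rw [vecOf_eq Q (hb δ hδ), ← val_getD, List.length_map]
    rfl
  rw [List.map_congr_left e] at h
  refine elimK_sound _ 127 le_rfl _ ?_ ?_
  · intro l hl j hj
    rw [List.mem_map] at hl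
    obtain ⟨δ, hδ, rfl⟩ := hl
    unfold digs
    rw [List.getD_eq_getElem _ _ (by simpa using hj), List.getElem_map]
    have hm : (cols Q)[j] ∈ cols Q := List.getElem_mem _
    generalize (cols Q)[j] = pe at hm
    simp only [cols, List.mem_flatMap, List.mem_map] at hm
    obtain ⟨q, _, e, he, rfl⟩ := hm
    have h1 := monN_lt (hb δ hδ) (List.mem_of_mem_take he)
    have h2 : chrN q.2 δ ≤ 65521 := (Nat.mod_lt _ (by norm_num)).le
    calc entry δ (q.2, e) ≤ 2 ^ 15 * 65521 := Nat.mul_le_mul h1 h2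
      _ ≤ _ := by norm_num
  · rw [List.map_map]; exact h

def castZ (δ : ℕ × ℕ × ℕ) : Z3 := (δ.1, δ.2.1, δ.2.2)

def castQ (p : ℕ × ℕ × ℕ) : Q3 := (p.1, p.2.1, p.2.2)

theorem castZ_inj : Function.Injective castZ := by
  rintro ⟨a, b, c⟩ ⟨a', b', c'⟩ h
  simpa [castZ] using h

theorem castQ_inj : Function.Injective castQ := by
  rintro ⟨a, b, c⟩ ⟨a', b', c'⟩ h
  simpa [castQ] using h

/-- The finite set of lattice points given by a list. -/
def ofL (L : List (ℕ × ℕ × ℕ)) : Finset Z3 := (L.map castZ).toFinset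

def msOf (x y z u : ℕ) : Multiset ℕ :=
  Multiset.replicate x 4 + (Multiset.replicate y 3 +
    (Multiset.replicate z 2 + Multiset.replicate u 1))

theorem msOf_eq (x y z u : ℕ) : msOf x y z u = (msList x y z u : Multiset ℕ) := by
  simp only [msOf, msList, ← Multiset.coe_add, Multiset.coe_replicate]

theorem exists_primitive {α : Type*} (L : List α) (c : α → ℚ) (h : ∃ a ∈ L, c a ≠ 0) :
    ∃ (t : ℚ) (z : α → ℤ), (∀ a ∈ L, t * c a = z a) ∧ ∃ a ∈ L, ¬ (65521 : ℤ) ∣ z a := by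
  classical
  obtain ⟨b, hb⟩ := IsLocalization.exist_integer_multiples_of_finset (nonZeroDivisors ℤ)
    (L.map c).toFinset
  have hb' : ∀ a ∈ L, ∃ z : ℤ, (z : ℚ) = (b : ℤ) * c a := by
    intro a ha
    obtain ⟨z, hz⟩ := hb (c a) (by simpa using ⟨a, ha, rfl⟩)
    exact ⟨z, by simpa [Submonoid.smul_def] using hz⟩
  choose! f hf using hb'
  have hb0 : ((b : ℤ) : ℚ) ≠ 0 := by
    exact_mod_cast nonZeroDivisors.ne_zero b.2
  obtain ⟨a0, ha0, hc0⟩ := h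
  obtain ⟨g, hg, hg1⟩ := Finset.extract_gcd (s := L.toFinset) f ⟨a0, by simpa using ha0⟩
  set G := L.toFinset.gcd f with hG
  have hG0 : (G : ℚ) ≠ 0 := by
    intro h0
    have h1 := hg a0 (by simpa using ha0)
    have h2 : G = 0 := by exact_mod_cast h0
    rw [h2, zero_mul] at h1
    have h3 := hf a0 ha0
    rw [h1] at h3
    exact mul_ne_zero hb0 hc0 (by rw [← h3]; simp)
  refine ⟨(b : ℤ) / G, g, ?_, ?_⟩
  · intro a ha
    have h1 := hf a ha
    rw [hg a (by simpa using ha)] at h1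
    push_cast at h1
    field_simp
    linarith
  · by_contra hcon
    push Not at hcon
    have : (65521 : ℤ) ∣ L.toFinset.gcd g := Finset.dvd_gcd fun a ha => hcon a (by simpa using ha)
    rw [hg1] at this
    norm_num at this

theorem comb_map {α : Type*} (L : List α) (z : α → ZMod 65521) (l : α → ℕ → ℕ) (j : ℕ) :
    comb (L.map z) (L.map l) j = (L.map fun a => z a * (l a j : ZMod 65521)).sum := by
  induction L with
  | nil => rfl
  | cons a L ih => simp only [List.map, comb, ih, List.sum_cons]

theorem zip_snd_sublist {α β : Type*} (l : List α) (l' : List β) :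
    ((l.zip l').map Prod.snd).Sublist l' := by
  induction l generalizing l' with
  | nil => simp
  | cons a l ih =>
    cases l' with
    | nil => simp
    | cons b l' => simpa using ih l'

theorem ptsP_nodup : ptsP.Nodup := by decide

theorem ptsP_pos : ∀ p ∈ ptsP, p.1 ≠ 0 ∧ p.2.1 ≠ 0 ∧ p.2.2 ≠ 0 := by decide

theorem monExp_take : ∀ m ∈ [1, 2, 3, 4], ∀ e ∈ monExp.take (nsl m),
    e.1 + e.2.1 + e.2.2 < m := by decide

theorem rank_sound {L : List (ℕ × ℕ × ℕ)} {x y z u : ℕ} (hN : L.Nodup)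
    (hb : ∀ δ ∈ L, δ.1 < 32 ∧ δ.2.1 < 32 ∧ δ.2.2 < 32) (hk : x + y + z + u ≤ 40)
    (h : rankCheck L x y z u = true) : Inj (ofL L) (msOf x y z u) := by
  have hI := rankCheck_IndF hb hk h
  set Q := (msList x y z u).zip ptsP with hQ
  have hl : ptsP.length = 40 := by decide
  have hQ1 : Q.map Prod.fst = msList x y z u :=
    List.map_fst_zip (by simp [msList, hl]; omega)
  have hQm : ∀ q ∈ Q, q.1 ∈ [1, 2, 3, 4] := by
    intro q hq
    have : q.1 ∈ msList x y z u := by rw [← hQ1]; exact List.mem_map_of_mem hq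
    simp only [msList, List.mem_append, List.mem_replicate] at this
    simp only [List.mem_cons]
    tauto
  refine ⟨(Q.map fun q => (q.1, castQ q.2) : List (ℕ × Q3)), ?_, ?_, ?_, ?_⟩
  · rw [msOf_eq, ← hQ1, Multiset.map_coe, List.map_map]; rfl
  · rw [Multiset.map_coe, Multiset.coe_nodup, List.map_map]
    have : (Q.map (Prod.snd ∘ fun q => ((q.1, castQ q.2) : ℕ × Q3))) =
      (Q.map Prod.snd).map castQ := by rw [List.map_map]; rfl
    rw [this]
    refine List.Nodup.map castQ_inj ?_
    exact ptsP_nodup.sublist (zip_snd_sublist _ _)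
  · intro mp hmp
    rw [Multiset.mem_coe, List.mem_map] at hmp
    obtain ⟨q, hq, rfl⟩ := hmp
    have := ptsP_pos q.2 (List.of_mem_zip hq).2
    simpa [tor, castQ] using this
  · intro c hc
    by_contra hcon
    push Not at hcon
    obtain ⟨δ0, hδ0, hc0⟩ := hcon
    have hex : ∃ a ∈ L, c (castZ a) ≠ 0 := by
      simp only [ofL, List.mem_toFinset, List.mem_map] at hδ0
      obtain ⟨a, ha, rfl⟩ := hδ0
      exact ⟨a, ha, hc0⟩
    obtain ⟨t, zz, hz, a1, ha1, hnd⟩ := exists_primitive L (fun a => c (castZ a)) hex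
    apply hnd
    have h0 := hI (L.map fun a => (zz a : ZMod 65521)) (by simp) ?_ (zz a1 : ZMod 65521)
      (List.mem_map_of_mem ha1)
    · exact_mod_cast (ZMod.intCast_zmod_eq_zero_iff_dvd _ 65521).1 h0
    · intro j hj
      rw [comb_map]
      have hm : (cols Q)[j] ∈ cols Q := List.getElem_mem _
      have hd : ∀ a, digs Q a j = entry a (cols Q)[j] := by
        intro a
        unfold digs
        rw [List.getD_eq_getElem _ _ (by simpa using hj), List.getElem_map]
      simp only [hd]
      generalize (cols Q)[j] = pe at hm
      simp only [cols, List.mem_flatMap, List.mem_map] at hm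
      obtain ⟨q, hq, e, he, rfl⟩ := hm
      have hc1 := hc (q.1, castQ q.2) (by
        rw [Multiset.mem_coe]; exact List.mem_map_of_mem (f := fun q => (q.1, castQ q.2)) hq)
        e.1 e.2.1 e.2.2
        (monExp_take q.1 (hQm q hq) e he)
      rw [ofL, List.sum_toFinset _ (hN.map castZ_inj), List.map_map] at hc1
      set N : (ℕ × ℕ × ℕ) → ℕ := fun a => monN a e * (q.2.1 ^ a.1 * q.2.2.1 ^ a.2.1 *
        q.2.2.2 ^ a.2.2) with hNdef
      have e1 : ∀ a, ((entry a (q.2, e) : ℕ) : ZMod 65521) = (N a : ℕ) := by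
        intro a
        simp only [entry, chrN, hNdef]
        push_cast [ZMod.natCast_mod]
        rfl
      simp only [e1]
      have e2 : (L.map fun a => ((zz a * N a : ℤ) : ℚ)).sum = 0 := by
        have : (L.map fun a => ((zz a * N a : ℤ) : ℚ)) = (L.map fun a => t * (c (castZ a) *
            (mon e.1 e.2.1 e.2.2 (castZ a) * chr (castQ q.2) (castZ a)))) := by
          apply List.map_congr_left
          intro a ha
          push_cast
          rw [← hz a ha]
          simp only [hNdef, monN, mon, chr, castZ, castQ]
          push_cast
          simp only [zpow_natCast]
          ring
        rw [this, List.sum_map_mul_left]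
        have h3 : (L.map fun a => (c (castZ a) *
            (mon e.1 e.2.1 e.2.2 (castZ a) * chr (castQ q.2) (castZ a)))).sum = 0 := hc1
        rw [h3, mul_zero]
      have e3 : (L.map fun a => (zz a * N a : ℤ)).sum = 0 := by
        have : (((L.map fun a => (zz a * N a : ℤ)).sum : ℤ) : ℚ) = 0 := by
          rw [← e2, Int.cast_list_sum, List.map_map]; rfl
        exact_mod_cast this
      have e4 := congrArg (Int.castRingHom (ZMod 65521)) e3
      rw [map_list_sum, List.map_map, map_zero] at e4
      rw [← e4]
      congr 1
      apply List.map_congr_left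
      intro a _
      simp


/-! ## Combining pieces -/

abbrev V4 := ℕ × ℕ × ℕ × ℕ

/-- Numbers of points of multiplicity 4, 3, 2, 1 imposing injective conditions on `D`. -/
def GG (D : Finset Z3) : Set V4 := fun v => Inj D (msOf v.1 v.2.1 v.2.2.1 v.2.2.2)

def Full (N : ℕ) (A : Set V4) : Prop :=
  ∀ x y z u : ℕ, u ≤ 3 → N ≤ 20 * x + 10 * y + 4 * z + u → (x, y, z, u) ∈ A

def addS (A C : Set V4) : Set V4 := fun v => ∃ a ∈ A, ∃ b ∈ C, a + b = v

theorem addS_mono {A A' C C' : Set V4} (h : A ⊆ A') (h' : C ⊆ C') : addS A C ⊆ addS A' C' := by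
  rintro v ⟨a, ha, b, hb, rfl⟩
  exact ⟨a, h ha, b, h' hb, rfl⟩

theorem Full.mono {N : ℕ} {A A' : Set V4} (h : Full N A) (hs : A ⊆ A') : Full N A' :=
  fun x y z u hu hN => hs (h x y z u hu hN)

theorem msOf_add (x y z u x' y' z' u' : ℕ) :
    msOf (x + x') (y + y') (z + z') (u + u') = msOf x y z u + msOf x' y' z' u' := by
  simp only [msOf, Multiset.replicate_add]
  abel

theorem msOf_le {x y z u x' y' z' u' : ℕ} (h1 : x ≤ x') (h2 : y ≤ y') (h3 : z ≤ z')
    (h4 : u ≤ u') : msOf x y z u ≤ msOf x' y' z' u' := by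
  obtain ⟨a, rfl⟩ := Nat.exists_eq_add_of_le h1
  obtain ⟨b, rfl⟩ := Nat.exists_eq_add_of_le h2
  obtain ⟨c, rfl⟩ := Nat.exists_eq_add_of_le h3
  obtain ⟨d, rfl⟩ := Nat.exists_eq_add_of_le h4
  rw [msOf_add]
  exact Multiset.le_add_right _ _

def Sea (M : ℕ) (D : Finset Z3) : Prop :=
  ∀ (C : Set V4) (N : ℕ), M ≤ N → Full N C → Full (N + D.card) (addS (GG D) C)

def FullD (D : Finset Z3) : Prop := Full D.card (GG D)

def IsCut (D D1 D2 : Finset Z3) : Prop := ∃ w : Z3, w ≠ 0 ∧ ∃ τ : ℤ,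
  (∀ δ, δ ∈ D1 ↔ δ ∈ D ∧ dot w δ < τ) ∧ (∀ δ, δ ∈ D2 ↔ δ ∈ D ∧ ¬ dot w δ < τ)

theorem IsCut.symm {D D1 D2 : Finset Z3} (h : IsCut D D1 D2) : IsCut D D2 D1 := by
  obtain ⟨w, hw, τ, h1, h2⟩ := h
  refine ⟨-w, neg_ne_zero.2 hw, 1 - τ, fun δ => ?_, fun δ => ?_⟩
  · rw [h2]
    have : dot (-w) δ = - dot w δ := by simp [dot]; ring
    rw [this]
    refine and_congr_right fun _ => ?_
    omega
  · rw [h1]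
    have : dot (-w) δ = - dot w δ := by simp [dot]; ring
    rw [this]
    refine and_congr_right fun _ => ?_
    omega

theorem IsCut.card {D D1 D2 : Finset Z3} (h : IsCut D D1 D2) : D.card = D1.card + D2.card := by
  obtain ⟨w, hw, τ, h1, h2⟩ := h
  have e1 : D1 = D.filter fun δ => dot w δ < τ := by ext δ; rw [h1, Finset.mem_filter]
  have e2 : D2 = D.filter fun δ => ¬ dot w δ < τ := by ext δ; rw [h2, Finset.mem_filter]
  rw [e1, e2, Finset.card_filter_add_card_filter_not]

theorem IsCut.GG {D D1 D2 : Finset Z3} (h : IsCut D D1 D2) : addS (GG D1) (GG D2) ⊆ GG D := by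
  obtain ⟨w, hw, τ, h1, h2⟩ := h
  have e1 : D1 = D.filter fun δ => dot w δ < τ := by ext δ; rw [h1, Finset.mem_filter]
  have e2 : D2 = D.filter fun δ => ¬ dot w δ < τ := by ext δ; rw [h2, Finset.mem_filter]
  subst e1 e2
  rintro v ⟨a, ha, b, hb, rfl⟩
  have := Inj.cut w hw τ ha hb
  rw [← msOf_add] at this
  exact this

theorem Sea.cut {M : ℕ} {D D1 D2 : Finset Z3} (hc : IsCut D D1 D2) (h1 : Sea M D1)
    (h2 : Sea M D2) : Sea M D := by
  intro C N hN hC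
  have := h1 _ _ (by omega) (h2 C N hN hC)
  rw [hc.card, add_comm D1.card, ← add_assoc]
  refine this.mono ?_
  rintro v ⟨a, ha, b, ⟨b1, hb1, b2, hb2, rfl⟩, rfl⟩
  exact ⟨a + b1, hc.GG ⟨a, ha, b1, hb1, rfl⟩, b2, hb2, add_assoc _ _ _⟩

theorem Sea.full_cut {M : ℕ} {D D1 D2 : Finset Z3} (hc : IsCut D D1 D2) (h1 : Sea M D1)
    (h2 : FullD D2) (hM : M ≤ D2.card) : FullD D := by
  have := h1 _ _ hM h2
  unfold FullD
  rw [hc.card, add_comm]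
  exact this.mono hc.GG

theorem GG.shift {D E : Finset Z3} (s : Z3) (hE : ∀ δ, δ ∈ E ↔ δ - s ∈ D) : GG D ⊆ GG E :=
  fun _ hv => Inj.shift hv s hE

theorem card_shift {D E : Finset Z3} (s : Z3) (hE : ∀ δ, δ ∈ E ↔ δ - s ∈ D) :
    E.card = D.card := by
  apply Finset.card_bij' (fun δ _ => δ - s) (fun δ _ => δ + s)
  · intro a ha; exact (hE a).1 ha
  · intro a ha; rw [hE]; simpa using ha
  · intro a _; simp
  · intro a _; simp

/-- A leaf: as many points as needed of a single multiplicity, for each multiplicity. -/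
theorem Sea.leaf {D : Finset Z3} {k : ℕ} (hD : D.card = 20 * k)
    (h4 : Inj D (msOf k 0 0 0)) (h3 : Inj D (msOf 0 (2 * k) 0 0))
    (h2 : Inj D (msOf 0 0 (5 * k) 0)) {M : ℕ} (hM : 40 * k ≤ M + 30) : Sea M D := by
  intro C N hN hC x y z u hu hw
  rw [hD] at hw
  by_cases hx : k ≤ x
  · refine ⟨(k, 0, 0, 0), h4, (x - k, y, z, u), hC _ _ _ _ hu (by omega), ?_⟩
    ext <;> simp; omega
  by_cases hy : 2 * k ≤ y
  · refine ⟨(0, 2 * k, 0, 0), h3, (x, y - 2 * k, z, u), hC _ _ _ _ hu (by omega), ?_⟩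
    ext <;> simp; omega
  by_cases hz : 5 * k ≤ z
  · refine ⟨(0, 0, 5 * k, 0), h2, (x, y, z - 5 * k, u), hC _ _ _ _ hu (by omega), ?_⟩
    ext <;> simp; omega
  omega

/-! ### Regions given by predicates -/

def SeaP (P : ℤ → ℤ → ℤ → Prop) : Prop :=
  ∃ D : Finset Z3, (∀ a b c, (a, b, c) ∈ D ↔ P a b c) ∧ Sea 220 D

def FullP (P : ℤ → ℤ → ℤ → Prop) : Prop :=
  ∃ D : Finset Z3, (∀ a b c, (a, b, c) ∈ D ↔ P a b c) ∧ 220 ≤ D.card ∧ FullD D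

theorem SeaP.shift {P P' : ℤ → ℤ → ℤ → Prop} (h : SeaP P) (s t r : ℤ)
    (hP : ∀ a b c, P' a b c ↔ P (a - s) (b - t) (c - r)) : SeaP P' := by
  obtain ⟨D, hD, hS⟩ := h
  have hE : ∀ δ, δ ∈ D.map (Equiv.addRight ((s, t, r) : Z3)).toEmbedding ↔ δ - (s, t, r) ∈ D := by
    intro δ
    rw [Finset.mem_map_equiv]
    simp [sub_eq_add_neg]
  refine ⟨D.map (Equiv.addRight ((s, t, r) : Z3)).toEmbedding,
    fun a b c => ?_, fun C N hN hC => ?_⟩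
  · rw [hE, hP, ← hD]; rfl
  · rw [card_shift _ hE]
    exact (hS C N hN hC).mono (addS_mono (GG.shift _ hE) subset_rfl)

theorem FullP.shift {P P' : ℤ → ℤ → ℤ → Prop} (h : FullP P) (s t r : ℤ)
    (hP : ∀ a b c, P' a b c ↔ P (a - s) (b - t) (c - r)) : FullP P' := by
  obtain ⟨D, hD, hc, hS⟩ := h
  have hE : ∀ δ, δ ∈ D.map (Equiv.addRight ((s, t, r) : Z3)).toEmbedding ↔ δ - (s, t, r) ∈ D := by
    intro δ
    rw [Finset.mem_map_equiv]
    simp [sub_eq_add_neg]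
  refine ⟨D.map (Equiv.addRight ((s, t, r) : Z3)).toEmbedding,
    fun a b c => ?_, ?_, ?_⟩
  · rw [hE, hP, ← hD]; rfl
  · rw [card_shift _ hE]; exact hc
  · unfold FullD
    rw [card_shift _ hE]
    exact Full.mono hS (GG.shift _ hE)

theorem isCut_union {P P1 P2 : ℤ → ℤ → ℤ → Prop} {D1 D2 : Finset Z3} (w1 w2 w3 τ : ℤ)
    (hw : w1 ≠ 0 ∨ w2 ≠ 0 ∨ w3 ≠ 0) (h1 : ∀ a b c, (a, b, c) ∈ D1 ↔ P1 a b c)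
    (h2 : ∀ a b c, (a, b, c) ∈ D2 ↔ P2 a b c)
    (e1 : ∀ a b c, P1 a b c ↔ P a b c ∧ w1 * a + w2 * b + w3 * c < τ)
    (e2 : ∀ a b c, P2 a b c ↔ P a b c ∧ ¬ w1 * a + w2 * b + w3 * c < τ) :
    (∀ a b c, (a, b, c) ∈ D1 ∪ D2 ↔ P a b c) ∧ IsCut (D1 ∪ D2) D1 D2 := by
  have hm : ∀ a b c, (a, b, c) ∈ D1 ∪ D2 ↔ P a b c := by
    intro a b c
    rw [Finset.mem_union, h1, h2, e1, e2]
    tauto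
  refine ⟨hm, (w1, w2, w3), ?_, τ, ?_, ?_⟩
  · intro h
    simp only [Prod.mk_eq_zero] at h
    tauto
  · rintro ⟨a, b, c⟩
    rw [hm, h1, e1]; rfl
  · rintro ⟨a, b, c⟩
    rw [hm, h2, e2]; rfl

theorem SeaP.cut {P P1 P2 : ℤ → ℤ → ℤ → Prop} (w1 w2 w3 τ : ℤ)
    (hw : w1 ≠ 0 ∨ w2 ≠ 0 ∨ w3 ≠ 0) (h1 : SeaP P1) (h2 : SeaP P2)
    (e1 : ∀ a b c, P1 a b c ↔ P a b c ∧ w1 * a + w2 * b + w3 * c < τ)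
    (e2 : ∀ a b c, P2 a b c ↔ P a b c ∧ ¬ w1 * a + w2 * b + w3 * c < τ) : SeaP P := by
  obtain ⟨D1, m1, s1⟩ := h1
  obtain ⟨D2, m2, s2⟩ := h2
  obtain ⟨hm, hc⟩ := isCut_union w1 w2 w3 τ hw m1 m2 e1 e2
  exact ⟨D1 ∪ D2, hm, Sea.cut hc s1 s2⟩

/-- First piece `Sea`, second piece `Full`. -/
theorem FullP.cut {P P1 P2 : ℤ → ℤ → ℤ → Prop} (w1 w2 w3 τ : ℤ)
    (hw : w1 ≠ 0 ∨ w2 ≠ 0 ∨ w3 ≠ 0) (h1 : SeaP P1) (h2 : FullP P2)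
    (e1 : ∀ a b c, P1 a b c ↔ P a b c ∧ w1 * a + w2 * b + w3 * c < τ)
    (e2 : ∀ a b c, P2 a b c ↔ P a b c ∧ ¬ w1 * a + w2 * b + w3 * c < τ) : FullP P := by
  obtain ⟨D1, m1, s1⟩ := h1
  obtain ⟨D2, m2, c2, s2⟩ := h2
  obtain ⟨hm, hc⟩ := isCut_union w1 w2 w3 τ hw m1 m2 e1 e2
  exact ⟨D1 ∪ D2, hm, by rw [hc.card]; omega, Sea.full_cut hc s1 s2 c2⟩

/-- First piece `Full`, second piece `Sea`. -/
theorem FullP.cut' {P P1 P2 : ℤ → ℤ → ℤ → Prop} (w1 w2 w3 τ : ℤ)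
    (hw : w1 ≠ 0 ∨ w2 ≠ 0 ∨ w3 ≠ 0) (h1 : FullP P1) (h2 : SeaP P2)
    (e1 : ∀ a b c, P1 a b c ↔ P a b c ∧ w1 * a + w2 * b + w3 * c < τ)
    (e2 : ∀ a b c, P2 a b c ↔ P a b c ∧ ¬ w1 * a + w2 * b + w3 * c < τ) : FullP P := by
  obtain ⟨D1, m1, c1, s1⟩ := h1
  obtain ⟨D2, m2, s2⟩ := h2
  obtain ⟨hm, hc⟩ := isCut_union w1 w2 w3 τ hw m1 m2 e1 e2
  exact ⟨D1 ∪ D2, hm, by rw [hc.card]; omega, Sea.full_cut hc.symm s2 s1 c1⟩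

/-! ### Certificates -/

abbrev N3 := ℕ × ℕ × ℕ

/-- A cut `(w₁ + 6, w₂ + 6, w₃ + 6, τ + 100)`. -/
abbrev CutN := ℕ × ℕ × ℕ × ℕ

def below (k : CutN) (p : N3) : Bool :=
  Nat.blt (Nat.add (Nat.add (Nat.add (Nat.mul k.1 p.1) (Nat.mul k.2.1 p.2.1))
    (Nat.mul k.2.2.1 p.2.2)) 100)
    (Nat.add k.2.2.2 (Nat.mul 6 (Nat.add (Nat.add p.1 p.2.1) p.2.2)))

noncomputable def partK (k : CutN) (L : List N3) : (List N3 → List N3 → Bool) → Bool :=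
  List.rec (fun f => f [] []) (fun p _ r f => r fun l1 l2 =>
    cond (below k p) (f (p :: l1) l2) (f l1 (p :: l2))) L

theorem partK_eq (k : CutN) (L : List N3) (f : List N3 → List N3 → Bool) :
    partK k L f = f (L.filter (below k)) (L.filter fun p => !below k p) := by
  induction L generalizing f with
  | nil => rfl
  | cons p L ih =>
    have e : partK k (p :: L) f = partK k L fun l1 l2 =>
      cond (below k p) (f (p :: l1) l2) (f l1 (p :: l2)) := rfl
    rw [e, ih]
    cases h : below k p <;> simp [List.filter_cons, h]

noncomputable def rk (L : List N3) (x y z u : ℕ) : Bool :=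
  force x fun x => force y fun y => force z fun z => force u fun u =>
    cond (Nat.ble (x + y + z + u) 40) (rankCheck L x y z u) false

theorem rk_sound {L : List N3} {x y z u : ℕ} (hN : L.Nodup)
    (hb : ∀ δ ∈ L, δ.1 < 32 ∧ δ.2.1 < 32 ∧ δ.2.2 < 32)
    (h : rk L x y z u = true) : Inj (ofL L) (msOf x y z u) := by
  simp only [rk, force_eq] at h
  cases hk : Nat.ble (x + y + z + u) 40
  · rw [hk] at h; cases h
  · rw [hk, cond_true] at h
    exact rank_sound hN hb (Nat.le_of_ble_eq_true hk) h

/-- Check a leaf which has to be used with at least `M` conditions left. -/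
noncomputable def puCheck (L : List N3) (M : ℕ) : Bool :=
  force (L.length / 20) fun k =>
    cond (Nat.beq L.length (20 * k)) (cond (Nat.ble (40 * k) (M + 30))
      (cond (rk L k 0 0 0) (cond (rk L 0 (2 * k) 0 0) (rk L 0 0 (5 * k) 0) false) false)
      false) false

theorem card_ofL {L : List N3} (hN : L.Nodup) : (ofL L).card = L.length := by
  rw [ofL, List.toFinset_card_of_nodup (hN.map castZ_inj), List.length_map]

theorem cond_eq_true' {a b : Bool} : cond a b false = true ↔ a = true ∧ b = true := by
  cases a <;> simp

theorem puCheck_sound {L : List N3} {M : ℕ} (hN : L.Nodup)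
    (hb : ∀ δ ∈ L, δ.1 < 32 ∧ δ.2.1 < 32 ∧ δ.2.2 < 32)
    (h : puCheck L M = true) : Sea M (ofL L) := by
  simp only [puCheck, force_eq, cond_eq_true'] at h
  obtain ⟨h1, h2, h3, h4, h5⟩ := h
  exact Sea.leaf ((card_ofL hN).trans (Nat.eq_of_beq_eq_true h1)) (rk_sound hN hb h3)
    (rk_sound hN hb h4) (rk_sound hN hb h5) (Nat.le_of_ble_eq_true h2)

def nzCut (k : CutN) : Bool := !(Nat.beq k.1 6 && Nat.beq k.2.1 6 && Nat.beq k.2.2.1 6)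

theorem mem_ofL {L : List N3} {a b c : ℤ} : (a, b, c) ∈ ofL L ↔
    0 ≤ a ∧ 0 ≤ b ∧ 0 ≤ c ∧ (a.toNat, b.toNat, c.toNat) ∈ L := by
  simp only [ofL, List.mem_toFinset, List.mem_map, castZ]
  constructor
  · rintro ⟨⟨x, y, z⟩, hm, he⟩
    simp only [Prod.mk.injEq] at he
    obtain ⟨rfl, rfl, rfl⟩ := he
    simpa using hm
  · rintro ⟨h1, h2, h3, hm⟩
    exact ⟨_, hm, by simp [h1, h2, h3]⟩

theorem isCut_below {k : CutN} (hk : nzCut k = true) (L : List N3) :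
    IsCut (ofL L) (ofL (L.filter (below k))) (ofL (L.filter fun p => !below k p)) := by
  have key : ∀ a b c : ℤ, 0 ≤ a → 0 ≤ b → 0 ≤ c →
      (below k (a.toNat, b.toNat, c.toNat) = true ↔
      dot ((k.1 : ℤ) - 6, (k.2.1 : ℤ) - 6, (k.2.2.1 : ℤ) - 6) (a, b, c) < (k.2.2.2 : ℤ) - 100) := by
    intro a b c ha hb hc
    lift a to ℕ using ha
    lift b to ℕ using hb
    lift c to ℕ using hc
    simp only [Int.toNat_natCast, dot]
    have : below k (a, b, c) = true ↔
        k.1 * a + k.2.1 * b + k.2.2.1 * c + 100 < k.2.2.2 + 6 * (a + b + c) := by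
      unfold below
      rw [Nat.blt_eq]
      rfl
    rw [this]
    zify
    constructor <;> intro h <;> linarith
  refine ⟨((k.1 : ℤ) - 6, (k.2.1 : ℤ) - 6, (k.2.2.1 : ℤ) - 6), ?_, (k.2.2.2 : ℤ) - 100, ?_, ?_⟩
  · intro h
    simp only [Prod.mk_eq_zero] at h
    have h1 : k.1 = 6 := by omega
    have h2 : k.2.1 = 6 := by omega
    have h3 : k.2.2.1 = 6 := by omega
    simp [nzCut, h1, h2, h3] at hk
  · rintro ⟨a, b, c⟩
    rw [mem_ofL, mem_ofL, List.mem_filter]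
    constructor
    · rintro ⟨h1, h2, h3, h4, h5⟩
      exact ⟨⟨h1, h2, h3, h4⟩, (key a b c h1 h2 h3).1 h5⟩
    · rintro ⟨⟨h1, h2, h3, h4⟩, h5⟩
      exact ⟨h1, h2, h3, h4, (key a b c h1 h2 h3).2 h5⟩
  · rintro ⟨a, b, c⟩
    rw [mem_ofL, mem_ofL, List.mem_filter]
    constructor
    · rintro ⟨h1, h2, h3, h4, h5⟩
      refine ⟨⟨h1, h2, h3, h4⟩, fun h6 => ?_⟩
      rw [(key a b c h1 h2 h3).2 h6] at h5
      cases h5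
    · rintro ⟨⟨h1, h2, h3, h4⟩, h5⟩
      refine ⟨h1, h2, h3, h4, ?_⟩
      cases hh : below k (a.toNat, b.toNat, c.toNat)
      · rfl
      · exact absurd ((key a b c h1 h2 h3).1 hh) h5

noncomputable def seaCheck (K : List CutN) : List N3 → Bool :=
  List.rec (fun L => puCheck L 220) (fun k _ r L => partK k L fun l1 l2 =>
    cond (nzCut k) (cond (puCheck l1 220) (r l2) false) false) K

theorem seaCheck_sound {K : List CutN} {L : List N3} (hN : L.Nodup)
    (hb : ∀ δ ∈ L, δ.1 < 32 ∧ δ.2.1 < 32 ∧ δ.2.2 < 32)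
    (h : seaCheck K L = true) : Sea 220 (ofL L) := by
  induction K generalizing L with
  | nil => exact puCheck_sound hN hb h
  | cons k K ih =>
    have e : seaCheck (k :: K) L = partK k L fun l1 l2 =>
      cond (nzCut k) (cond (puCheck l1 220) (seaCheck K l2) false) false := rfl
    rw [e, partK_eq, cond_eq_true', cond_eq_true'] at h
    exact Sea.cut (isCut_below h.1 L)
      (puCheck_sound (hN.filter _) (fun δ hδ => hb δ (List.mem_of_mem_filter hδ)) h.2.1)
      (ih (hN.filter _) (fun δ hδ => hb δ (List.mem_of_mem_filter hδ)) h.2.2)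

noncomputable def dirCheck (L : List N3) : Bool :=
  force L.length fun N => (List.range ((N + 19) / 20 + 1)).all fun x =>
    (List.range ((N - 20 * x + 9) / 10 + 1)).all fun y =>
      force (N - 20 * x - 10 * y) fun m =>
        cond (rk L x y (m / 4) (m % 4))
          (cond (Nat.beq (m % 4) 0) true (rk L x y (m / 4 + 1) 0)) false

theorem dirCheck_sound {L : List N3} (hN : L.Nodup)
    (hb : ∀ δ ∈ L, δ.1 < 32 ∧ δ.2.1 < 32 ∧ δ.2.2 < 32)
    (h : dirCheck L = true) : FullD (ofL L) := by
  simp only [dirCheck, force_eq] at h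
  unfold FullD
  rw [card_ofL hN]
  generalize L.length = N at h
  have key : ∀ x y, x < (N + 19) / 20 + 1 → y < (N - 20 * x + 9) / 10 + 1 →
      Inj (ofL L) (msOf x y ((N - 20 * x - 10 * y) / 4) ((N - 20 * x - 10 * y) % 4)) ∧
      ((N - 20 * x - 10 * y) % 4 ≠ 0 →
        Inj (ofL L) (msOf x y ((N - 20 * x - 10 * y) / 4 + 1) 0)) := by
    intro x y hx hy
    rw [List.all_eq_true] at h
    have h1 := h x (List.mem_range.2 hx)
    rw [List.all_eq_true] at h1
    have h2 := h1 y (List.mem_range.2 hy)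
    rw [cond_eq_true'] at h2
    refine ⟨rk_sound hN hb h2.1, fun h0 => rk_sound hN hb ?_⟩
    have h3 := h2.2
    cases h4 : Nat.beq ((N - 20 * x - 10 * y) % 4) 0
    · rw [h4] at h3; exact h3
    · exact absurd (Nat.eq_of_beq_eq_true h4) h0
  intro x y z u hu hw
  have up : ∀ x' y' z' u', x' ≤ x → y' ≤ y → z' ≤ z → u' ≤ u → Inj (ofL L) (msOf x' y' z' u') →
      (x, y, z, u) ∈ GG (ofL L) := fun x' y' z' u' h1 h2 h3 h4 hI =>
    hI.mono_add (msOf_le h1 h2 h3 h4)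
  by_cases hx : (N + 19) / 20 < x
  · have := (key ((N + 19) / 20) 0 (by omega) (by omega)).1
    rw [show N - 20 * ((N + 19) / 20) - 10 * 0 = 0 by omega] at this
    exact up _ _ _ _ hx.le (Nat.zero_le _) (Nat.zero_le _) (Nat.zero_le _) this
  by_cases hy : (N - 20 * x + 9) / 10 < y
  · have := (key x ((N - 20 * x + 9) / 10) (by omega) (by omega)).1
    rw [show N - 20 * x - 10 * ((N - 20 * x + 9) / 10) = 0 by omega] at this
    exact up _ _ _ _ le_rfl hy.le (Nat.zero_le _) (Nat.zero_le _) this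
  obtain ⟨k1, k2⟩ := key x y (by omega) (by omega)
  by_cases hz : (N - 20 * x - 10 * y) / 4 + 1 ≤ z
  · by_cases h0 : (N - 20 * x - 10 * y) % 4 = 0
    · rw [h0] at k1
      exact up _ _ _ _ le_rfl le_rfl (by omega) (by omega) k1
    · exact up _ _ _ _ le_rfl le_rfl hz (by omega) (k2 h0)
  · exact up _ _ _ _ le_rfl le_rfl (by omega) (by omega) k1

noncomputable def fullCheck (K : List CutN) : List N3 → Bool :=
  List.rec (fun L => dirCheck L) (fun k _ r L => partK k L fun l1 l2 =>
    cond (nzCut k) (cond (puCheck l1 l2.length) (r l2) false) false) K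

theorem fullCheck_sound {K : List CutN} {L : List N3} (hN : L.Nodup)
    (hb : ∀ δ ∈ L, δ.1 < 32 ∧ δ.2.1 < 32 ∧ δ.2.2 < 32)
    (h : fullCheck K L = true) : FullD (ofL L) := by
  induction K generalizing L with
  | nil => exact dirCheck_sound hN hb h
  | cons k K ih =>
    have e : fullCheck (k :: K) L = partK k L fun l1 l2 =>
      cond (nzCut k) (cond (puCheck l1 l2.length) (fullCheck K l2) false) false := rfl
    rw [e, partK_eq, cond_eq_true', cond_eq_true'] at h
    exact Sea.full_cut (isCut_below h.1 L)
      (puCheck_sound (hN.filter _) (fun δ hδ => hb δ (List.mem_of_mem_filter hδ)) h.2.1)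
      (ih (hN.filter _) (fun δ hδ => hb δ (List.mem_of_mem_filter hδ)) h.2.2)
      (card_ofL (hN.filter _)).ge

/-- Evaluate the coordinates of all points before going on. -/
noncomputable def forceL (L : List N3) : (List N3 → Bool) → Bool :=
  List.rec (fun k => k []) (fun p _ r k => force p.1 fun a => force p.2.1 fun b =>
    force p.2.2 fun c => r fun l => k ((a, b, c) :: l)) L

theorem forceL_eq (L : List N3) (k : List N3 → Bool) : forceL L k = k L := by
  induction L generalizing k with
  | nil => rfl
  | cons p L ih =>
    have e : forceL (p :: L) k = force p.1 fun a => force p.2.1 fun b =>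
      force p.2.2 fun c => forceL L fun l => k ((a, b, c) :: l) := rfl
    rw [e]
    simp only [force_eq, ih]

/-- Lattice points of a box satisfying a condition. -/
def reg (A B C : ℕ) (f : N3 → Bool) : List N3 :=
  (List.range A ×ˢ (List.range B ×ˢ List.range C)).filter f

theorem reg_nodup (A B C : ℕ) (f : N3 → Bool) : (reg A B C f).Nodup :=
  (List.nodup_range.product (List.nodup_range.product List.nodup_range)).filter _

theorem mem_reg {A B C : ℕ} {f : N3 → Bool} {a b c : ℕ} :
    (a, b, c) ∈ reg A B C f ↔ a < A ∧ b < B ∧ c < C ∧ f (a, b, c) = true := by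
  simp only [reg, List.mem_filter, List.mem_product, List.mem_range, and_assoc]

theorem reg_bound {A B C : ℕ} {f : N3 → Bool} (hA : A ≤ 32) (hB : B ≤ 32) (hC : C ≤ 32) :
    ∀ δ ∈ reg A B C f, δ.1 < 32 ∧ δ.2.1 < 32 ∧ δ.2.2 < 32 := by
  rintro ⟨a, b, c⟩ h
  rw [mem_reg] at h
  simp only
  omega

theorem SeaP.of_check {A B C : ℕ} {f : N3 → Bool} {K : List CutN} (hA : A ≤ 32) (hB : B ≤ 32)
    (hC : C ≤ 32) (h : forceL (reg A B C f) (seaCheck K) = true) {P : ℤ → ℤ → ℤ → Prop}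
    (hP : ∀ a b c : ℤ, P a b c ↔ 0 ≤ a ∧ 0 ≤ b ∧ 0 ≤ c ∧
      (a.toNat < A ∧ b.toNat < B ∧ c.toNat < C ∧ f (a.toNat, b.toNat, c.toNat) = true)) :
    SeaP P := by
  rw [forceL_eq] at h
  refine ⟨ofL (reg A B C f), fun a b c => ?_, seaCheck_sound (reg_nodup _ _ _ _)
    (reg_bound hA hB hC) h⟩
  rw [mem_ofL, hP, mem_reg]

theorem FullP.of_check {A B C : ℕ} {f : N3 → Bool} {K : List CutN} (hA : A ≤ 32) (hB : B ≤ 32)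
    (hC : C ≤ 32) (h : forceL (reg A B C f) (fun L => cond (Nat.ble 220 L.length)
      (fullCheck K L) false) = true) {P : ℤ → ℤ → ℤ → Prop}
    (hP : ∀ a b c : ℤ, P a b c ↔ 0 ≤ a ∧ 0 ≤ b ∧ 0 ≤ c ∧
      (a.toNat < A ∧ b.toNat < B ∧ c.toNat < C ∧ f (a.toNat, b.toNat, c.toNat) = true)) :
    FullP P := by
  rw [forceL_eq, cond_eq_true'] at h
  refine ⟨ofL (reg A B C f), fun a b c => ?_, ?_, fullCheck_sound (reg_nodup _ _ _ _)
    (reg_bound hA hB hC) h.2⟩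
  · rw [mem_ofL, hP, mem_reg]
  · rw [card_ofL (reg_nodup _ _ _ _)]; exact Nat.le_of_ble_eq_true h.1


/-! ## Base cases, by computation -/

theorem bnot_iff {b : Bool} : (!b) = true ↔ ¬ b = true := by cases b <;> simp

set_option maxRecDepth 100000 in
theorem sea_boxA : SeaP fun a b c => 0 ≤ a ∧ 0 ≤ b ∧ 0 ≤ c ∧ a < 4 ∧ b < 10 ∧ c < 4 :=
  SeaP.of_check (A := 4) (B := 10) (C := 4)
    (f := fun _ => true)
    (K := [(6, 4, 7, 93)])
    (by norm_num) (by norm_num) (by norm_num) (by decide +kernel) (by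
      intro a b c
      simp only [and_true]; omega)

set_option maxRecDepth 100000 in
theorem sea_boxB : SeaP fun a b c => 0 ≤ a ∧ 0 ≤ b ∧ 0 ≤ c ∧ a < 5 ∧ b < 8 ∧ c < 4 :=
  SeaP.of_check (A := 5) (B := 8) (C := 4)
    (f := fun _ => true)
    (K := [(5, 4, 7, 91)])
    (by norm_num) (by norm_num) (by norm_num) (by decide +kernel) (by
      intro a b c
      simp only [and_true]; omega)

set_option maxRecDepth 100000 in
theorem sea_colA11 : SeaP fun a b c => 0 ≤ a ∧ 0 ≤ b ∧ 0 ≤ c ∧ a < 4 ∧ b < 10 ∧ a + b + c ≤ 11 :=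
  SeaP.of_check (A := 4) (B := 10) (C := 12)
    (f := fun δ => Nat.ble (δ.1 + δ.2.1 + δ.2.2) 11)
    (K := [(1, 7, 2, 75), (11, 4, 10, 113)])
    (by norm_num) (by norm_num) (by norm_num) (by decide +kernel) (by
      intro a b c
      simp only [Nat.ble_eq]; omega)

set_option maxRecDepth 100000 in
theorem sea_colA13 : SeaP fun a b c => 0 ≤ a ∧ 0 ≤ b ∧ 0 ≤ c ∧ a < 4 ∧ b < 10 ∧ a + b + c ≤ 13 :=
  SeaP.of_check (A := 4) (B := 10) (C := 14)
    (f := fun δ => Nat.ble (δ.1 + δ.2.1 + δ.2.2) 13)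
    (K := [(1, 7, 2, 67), (1, 10, 0, 71), (1, 0, 9, 63), (7, 8, 5, 107)])
    (by norm_num) (by norm_num) (by norm_num) (by decide +kernel) (by
      intro a b c
      simp only [Nat.ble_eq]; omega)

set_option maxRecDepth 100000 in
theorem sea_slabB11 : SeaP fun a b c => 0 ≤ a ∧ 0 ≤ b ∧ 0 ≤ c ∧ b < 10 ∧ a + b + c ≤ 11 :=
  SeaP.of_check (A := 12) (B := 10) (C := 12)
    (f := fun δ => Nat.ble (δ.1 + δ.2.1 + δ.2.2) 11)
    (K := [(10, 4, 0, 74), (11, 0, 5, 87), (7, 3, 4, 91), (4, 3, 0, 78)])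
    (by norm_num) (by norm_num) (by norm_num) (by decide +kernel) (by
      intro a b c
      simp only [Nat.ble_eq]; omega)

set_option maxRecDepth 100000 in
theorem sea_T9 : SeaP fun a b c => 0 ≤ a ∧ 0 ≤ b ∧ 0 ≤ c ∧ a + b + c ≤ 9 :=
  SeaP.of_check (A := 10) (B := 10) (C := 10)
    (f := fun δ => Nat.ble (δ.1 + δ.2.1 + δ.2.2) 9)
    (K := [(8, 5, 7, 103), (8, 5, 7, 107)])
    (by norm_num) (by norm_num) (by norm_num) (by decide +kernel) (by
      intro a b c
      simp only [Nat.ble_eq]; omega)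

set_option maxRecDepth 100000 in
theorem sea_slab13 : SeaP fun a b c => 0 ≤ a ∧ 0 ≤ b ∧ 0 ≤ c ∧ a < 4 ∧ a + b + c ≤ 13 :=
  SeaP.of_check (A := 4) (B := 14) (C := 14)
    (f := fun δ => Nat.ble (δ.1 + δ.2.1 + δ.2.2) 13)
    (K := [(1, 7, 2, 67), (1, 1, 7, 60), (4, 4, 8, 94), (4, 11, 8, 118)])
    (by norm_num) (by norm_num) (by norm_num) (by decide +kernel) (by
      intro a b c
      simp only [Nat.ble_eq]; omega)

set_option maxRecDepth 100000 in
theorem sea_slab17 : SeaP fun a b c => 0 ≤ a ∧ 0 ≤ b ∧ 0 ≤ c ∧ a < 4 ∧ a + b + c ≤ 17 :=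
  SeaP.of_check (A := 4) (B := 18) (C := 18)
    (f := fun δ => Nat.ble (δ.1 + δ.2.1 + δ.2.2) 17)
    (K := [(1, 7, 2, 51), (1, 11, 1, 65), (8, 5, 8, 95), (8, 2, 11, 81), (6, 8, 8, 110), (5, 8, 5,
      99), (3, 10, 1, 83), (7, 4, 4, 80)])
    (by norm_num) (by norm_num) (by norm_num) (by decide +kernel) (by
      intro a b c
      simp only [Nat.ble_eq]; omega)

set_option maxRecDepth 100000 in
theorem sea_colB10 : SeaP fun a b c => 0 ≤ a ∧ 0 ≤ b ∧ 0 ≤ c ∧ a < 5 ∧ b < 8 ∧ a + b + c ≤ 10 :=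
  SeaP.of_check (A := 5) (B := 8) (C := 11)
    (f := fun δ => Nat.ble (δ.1 + δ.2.1 + δ.2.2) 10)
    (K := [(4, 11, 1, 89), (8, 1, 4, 85)])
    (by norm_num) (by norm_num) (by norm_num) (by decide +kernel) (by
      intro a b c
      simp only [Nat.ble_eq]; omega)

set_option maxRecDepth 100000 in
theorem sea_colB12 : SeaP fun a b c => 0 ≤ a ∧ 0 ≤ b ∧ 0 ≤ c ∧ a < 5 ∧ b < 8 ∧ a + b + c ≤ 12 :=
  SeaP.of_check (A := 5) (B := 8) (C := 13)
    (f := fun δ => Nat.ble (δ.1 + δ.2.1 + δ.2.2) 12)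
    (K := [(2, 8, 0, 60), (2, 0, 1, 52), (11, 4, 10, 117)])
    (by norm_num) (by norm_num) (by norm_num) (by decide +kernel) (by
      intro a b c
      simp only [Nat.ble_eq]; omega)

set_option maxRecDepth 100000 in
theorem sea_slab14 : SeaP fun a b c => 0 ≤ a ∧ 0 ≤ b ∧ 0 ≤ c ∧ a < 5 ∧ a + b + c ≤ 14 :=
  SeaP.of_check (A := 5) (B := 15) (C := 15)
    (f := fun δ => Nat.ble (δ.1 + δ.2.1 + δ.2.2) 14)
    (K := [(3, 2, 5, 60), (0, 10, 11, 108), (7, 4, 8, 95), (5, 7, 4, 84), (9, 9, 5, 110)])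
    (by norm_num) (by norm_num) (by norm_num) (by decide +kernel) (by
      intro a b c
      simp only [Nat.ble_eq]; omega)

set_option maxRecDepth 100000 in
theorem sea_Y21 : SeaP fun a b c => 0 ≤ a ∧ 0 ≤ b ∧ 0 ≤ c ∧ a < 5 ∧ a + b + c ≤ 10 ∧ ¬ (a = 4 ∧ 6 * (10 - 4) - 21 ≤ 6 * b - c) :=
  SeaP.of_check (A := 5) (B := 11) (C := 11)
    (f := fun δ => Nat.ble (δ.1 + δ.2.1 + δ.2.2) 10 &&
    !(Nat.beq δ.1 4 && Nat.ble (36 + δ.2.2) (6 * δ.2.1 + 21)))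
    (K := [(11, 2, 7, 96), (11, 3, 11, 115)])
    (by norm_num) (by norm_num) (by norm_num) (by decide +kernel) (by
      intro a b c
      simp only [Nat.ble_eq, Nat.beq_eq, Bool.and_eq_true, bnot_iff]; omega)

set_option maxRecDepth 100000 in
theorem sea_Y28 : SeaP fun a b c => 0 ≤ a ∧ 0 ≤ b ∧ 0 ≤ c ∧ a < 5 ∧ a + b + c ≤ 12 ∧ ¬ (a = 4 ∧ 6 * (12 - 4) - 28 ≤ 6 * b - c) :=
  SeaP.of_check (A := 5) (B := 13) (C := 13)
    (f := fun δ => Nat.ble (δ.1 + δ.2.1 + δ.2.2) 12 &&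
    !(Nat.beq δ.1 4 && Nat.ble (48 + δ.2.2) (6 * δ.2.1 + 28)))
    (K := [(1, 7, 2, 68), (4, 4, 6, 86), (2, 3, 7, 87)])
    (by norm_num) (by norm_num) (by norm_num) (by decide +kernel) (by
      intro a b c
      simp only [Nat.ble_eq, Nat.beq_eq, Bool.and_eq_true, bnot_iff]; omega)

set_option maxRecDepth 100000 in
theorem sea_Y13 : SeaP fun a b c => 0 ≤ a ∧ 0 ≤ b ∧ 0 ≤ c ∧ a < 5 ∧ a + b + c ≤ 16 ∧ ¬ (a = 4 ∧ 6 * (16 - 4) - 13 ≤ 6 * b - c) :=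
  SeaP.of_check (A := 5) (B := 17) (C := 17)
    (f := fun δ => Nat.ble (δ.1 + δ.2.1 + δ.2.2) 16 &&
    !(Nat.beq δ.1 4 && Nat.ble (72 + δ.2.2) (6 * δ.2.1 + 13)))
    (K := [(2, 8, 0, 36), (8, 5, 8, 96), (4, 2, 9, 68), (7, 5, 8, 102), (3, 8, 0, 47), (8, 7, 2,
      81), (7, 4, 4, 80), (4, 0, 6, 78)])
    (by norm_num) (by norm_num) (by norm_num) (by decide +kernel) (by
      intro a b c
      simp only [Nat.ble_eq, Nat.beq_eq, Bool.and_eq_true, bnot_iff]; omega)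

set_option maxRecDepth 100000 in
theorem full_T9 : FullP fun a b c => 0 ≤ a ∧ 0 ≤ b ∧ 0 ≤ c ∧ a + b + c ≤ 9 :=
  FullP.of_check (A := 10) (B := 10) (C := 10)
    (f := fun δ => Nat.ble (δ.1 + δ.2.1 + δ.2.2) 9)
    (K := [(0, 8, 12, 94), (12, 8, 0, 94), (10, 10, 3, 111)])
    (by norm_num) (by norm_num) (by norm_num) (by decide +kernel) (by
      intro a b c
      simp only [Nat.ble_eq]; omega)

set_option maxRecDepth 100000 in
theorem full_T10 : FullP fun a b c => 0 ≤ a ∧ 0 ≤ b ∧ 0 ≤ c ∧ a + b + c ≤ 10 :=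
  FullP.of_check (A := 11) (B := 11) (C := 11)
    (f := fun δ => Nat.ble (δ.1 + δ.2.1 + δ.2.2) 10)
    (K := [(3, 4, 1, 70), (9, 2, 6, 89), (6, 4, 2, 88), (9, 5, 5, 106)])
    (by norm_num) (by norm_num) (by norm_num) (by decide +kernel) (by
      intro a b c
      simp only [Nat.ble_eq]; omega)

set_option maxRecDepth 100000 in
theorem full_T11 : FullP fun a b c => 0 ≤ a ∧ 0 ≤ b ∧ 0 ≤ c ∧ a + b + c ≤ 11 :=
  FullP.of_check (A := 12) (B := 12) (C := 12)
    (f := fun δ => Nat.ble (δ.1 + δ.2.1 + δ.2.2) 11)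
    (K := [(10, 4, 0, 74), (8, 4, 1, 85), (12, 4, 4, 106), (8, 1, 8, 98), (10, 6, 0, 108)])
    (by norm_num) (by norm_num) (by norm_num) (by decide +kernel) (by
      intro a b c
      simp only [Nat.ble_eq]; omega)

set_option maxRecDepth 100000 in
theorem full_T12 : FullP fun a b c => 0 ≤ a ∧ 0 ≤ b ∧ 0 ≤ c ∧ a + b + c ≤ 12 :=
  FullP.of_check (A := 13) (B := 13) (C := 13)
    (f := fun δ => Nat.ble (δ.1 + δ.2.1 + δ.2.2) 12)
    (K := [(8, 5, 8, 100), (0, 5, 8, 68), (4, 2, 10, 84), (7, 7, 8, 109), (0, 7, 9, 95), (5, 2, 9,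
      97), (3, 6, 10, 118)])
    (by norm_num) (by norm_num) (by norm_num) (by decide +kernel) (by
      intro a b c
      simp only [Nat.ble_eq]; omega)

set_option maxRecDepth 100000 in
theorem full_T15 : FullP fun a b c => 0 ≤ a ∧ 0 ≤ b ∧ 0 ≤ c ∧ a + b + c ≤ 15 :=
  FullP.of_check (A := 16) (B := 16) (C := 16)
    (f := fun δ => Nat.ble (δ.1 + δ.2.1 + δ.2.2) 15)
    (K := [(8, 5, 8, 97), (2, 0, 10, 50), (1, 6, 9, 66), (4, 0, 6, 54), (3, 4, 1, 45), (6, 1, 0,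
      45), (2, 7, 4, 67), (5, 3, 0, 57), (2, 4, 0, 54), (0, 1, 10, 65), (9, 1, 5, 82), (11, 2,
      4, 96), (4, 5, 6, 92)])
    (by norm_num) (by norm_num) (by norm_num) (by decide +kernel) (by
      intro a b c
      simp only [Nat.ble_eq]; omega)

set_option maxRecDepth 100000 in
theorem full_slab10 : FullP fun a b c => 0 ≤ a ∧ 0 ≤ b ∧ 0 ≤ c ∧ a < 5 ∧ a + b + c ≤ 10 :=
  FullP.of_check (A := 5) (B := 11) (C := 11)
    (f := fun δ => Nat.ble (δ.1 + δ.2.1 + δ.2.2) 10)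
    (K := [(2, 8, 0, 72), (5, 4, 7, 92), (3, 1, 0, 68)])
    (by norm_num) (by norm_num) (by norm_num) (by decide +kernel) (by
      intro a b c
      simp only [Nat.ble_eq]; omega)

set_option maxRecDepth 100000 in
theorem full_slab12 : FullP fun a b c => 0 ≤ a ∧ 0 ≤ b ∧ 0 ≤ c ∧ a < 5 ∧ a + b + c ≤ 12 :=
  FullP.of_check (A := 5) (B := 13) (C := 13)
    (f := fun δ => Nat.ble (δ.1 + δ.2.1 + δ.2.2) 12)
    (K := [(2, 8, 0, 60), (8, 5, 8, 100), (3, 8, 0, 71), (3, 0, 5, 60), (7, 1, 0, 68), (12, 3, 7,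
      107)])
    (by norm_num) (by norm_num) (by norm_num) (by decide +kernel) (by
      intro a b c
      simp only [Nat.ble_eq]; omega)

set_option maxRecDepth 100000 in
theorem full_slab16 : FullP fun a b c => 0 ≤ a ∧ 0 ≤ b ∧ 0 ≤ c ∧ a < 5 ∧ a + b + c ≤ 16 :=
  FullP.of_check (A := 5) (B := 17) (C := 17)
    (f := fun δ => Nat.ble (δ.1 + δ.2.1 + δ.2.2) 16)
    (K := [(2, 8, 0, 36), (8, 5, 8, 96), (3, 10, 2, 72), (8, 3, 9, 84), (7, 3, 8, 87), (3, 7, 2,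
      72), (5, 2, 0, 53), (5, 7, 8, 104), (2, 7, 12, 111)])
    (by norm_num) (by norm_num) (by norm_num) (by decide +kernel) (by
      intro a b c
      simp only [Nat.ble_eq]; omega)

set_option maxRecDepth 100000 in
theorem full_X13_11 : FullP fun a b c => 0 ≤ a ∧ 0 ≤ b ∧ 0 ≤ c ∧ a + b + c ≤ 11 + 1 ∧ (a = 0 → 6 * (11 + 1) - 13 ≤ 6 * b - c) :=
  FullP.of_check (A := 13) (B := 13) (C := 13)
    (f := fun δ => Nat.ble (δ.1 + δ.2.1 + δ.2.2) 12 &&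
    (!Nat.beq δ.1 0 || Nat.ble (72 + δ.2.2) (6 * δ.2.1 + 13)))
    (K := [(0, 5, 8, 68), (2, 0, 4, 54), (1, 1, 10, 79), (8, 8, 5, 103), (8, 3, 10, 110)])
    (by norm_num) (by norm_num) (by norm_num) (by decide +kernel) (by
      intro a b c
      simp only [Nat.ble_eq, Nat.beq_eq, Bool.and_eq_true, Bool.or_eq_true, bnot_iff]
      omega)

set_option maxRecDepth 100000 in
theorem full_X21_11 : FullP fun a b c => 0 ≤ a ∧ 0 ≤ b ∧ 0 ≤ c ∧ a + b + c ≤ 11 + 1 ∧ (a = 0 → 6 * (11 + 1) - 21 ≤ 6 * b - c) :=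
  FullP.of_check (A := 13) (B := 13) (C := 13)
    (f := fun δ => Nat.ble (δ.1 + δ.2.1 + δ.2.2) 12 &&
    (!Nat.beq δ.1 0 || Nat.ble (72 + δ.2.2) (6 * δ.2.1 + 21)))
    (K := [(12, 1, 5, 87), (5, 3, 0, 66), (12, 2, 1, 99), (5, 8, 8, 100), (12, 5, 8, 128)])
    (by norm_num) (by norm_num) (by norm_num) (by decide +kernel) (by
      intro a b c
      simp only [Nat.ble_eq, Nat.beq_eq, Bool.and_eq_true, Bool.or_eq_true, bnot_iff]
      omega)

set_option maxRecDepth 100000 in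
theorem full_X28_11 : FullP fun a b c => 0 ≤ a ∧ 0 ≤ b ∧ 0 ≤ c ∧ a + b + c ≤ 11 + 1 ∧ (a = 0 → 6 * (11 + 1) - 28 ≤ 6 * b - c) :=
  FullP.of_check (A := 13) (B := 13) (C := 13)
    (f := fun δ => Nat.ble (δ.1 + δ.2.1 + δ.2.2) 12 &&
    (!Nat.beq δ.1 0 || Nat.ble (72 + δ.2.2) (6 * δ.2.1 + 28)))
    (K := [(12, 1, 5, 86), (8, 4, 1, 82), (5, 8, 8, 100), (3, 12, 5, 97), (0, 8, 4, 82)])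
    (by norm_num) (by norm_num) (by norm_num) (by decide +kernel) (by
      intro a b c
      simp only [Nat.ble_eq, Nat.beq_eq, Bool.and_eq_true, Bool.or_eq_true, bnot_iff]
      omega)

set_option maxRecDepth 100000 in
theorem full_X13_15 : FullP fun a b c => 0 ≤ a ∧ 0 ≤ b ∧ 0 ≤ c ∧ a + b + c ≤ 15 + 1 ∧ (a = 0 → 6 * (15 + 1) - 13 ≤ 6 * b - c) :=
  FullP.of_check (A := 17) (B := 17) (C := 17)
    (f := fun δ => Nat.ble (δ.1 + δ.2.1 + δ.2.2) 16 &&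
    (!Nat.beq δ.1 0 || Nat.ble (96 + δ.2.2) (6 * δ.2.1 + 13)))
    (K := [(0, 5, 8, 44), (8, 5, 2, 66), (11, 0, 1, 49), (8, 3, 0, 54), (0, 11, 9, 70), (5, 9, 1,
      73), (12, 2, 5, 91), (4, 0, 1, 41), (4, 5, 8, 86), (0, 3, 3, 49), (4, 1, 8, 78), (5, 3,
      0, 69), (3, 4, 1, 76)])
    (by norm_num) (by norm_num) (by norm_num) (by decide +kernel) (by
      intro a b c
      simp only [Nat.ble_eq, Nat.beq_eq, Bool.and_eq_true, Bool.or_eq_true, bnot_iff]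
      omega)

set_option maxRecDepth 100000 in
theorem full_X21_15 : FullP fun a b c => 0 ≤ a ∧ 0 ≤ b ∧ 0 ≤ c ∧ a + b + c ≤ 15 + 1 ∧ (a = 0 → 6 * (15 + 1) - 21 ≤ 6 * b - c) :=
  FullP.of_check (A := 17) (B := 17) (C := 17)
    (f := fun δ => Nat.ble (δ.1 + δ.2.1 + δ.2.2) 16 &&
    (!Nat.beq δ.1 0 || Nat.ble (96 + δ.2.2) (6 * δ.2.1 + 21)))
    (K := [(12, 1, 5, 67), (5, 8, 2, 63), (0, 5, 8, 44), (4, 7, 5, 84), (6, 8, 4, 94), (0, 0, 7,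
      29), (4, 7, 4, 84), (7, 2, 4, 71), (2, 3, 9, 72), (1, 2, 10, 75), (4, 2, 1, 61), (6, 4,
      5, 93)])
    (by norm_num) (by norm_num) (by norm_num) (by decide +kernel) (by
      intro a b c
      simp only [Nat.ble_eq, Nat.beq_eq, Bool.and_eq_true, Bool.or_eq_true, bnot_iff]
      omega)

set_option maxRecDepth 100000 in
theorem full_X28_15 : FullP fun a b c => 0 ≤ a ∧ 0 ≤ b ∧ 0 ≤ c ∧ a + b + c ≤ 15 + 1 ∧ (a = 0 → 6 * (15 + 1) - 28 ≤ 6 * b - c) :=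
  FullP.of_check (A := 17) (B := 17) (C := 17)
    (f := fun δ => Nat.ble (δ.1 + δ.2.1 + δ.2.2) 16 &&
    (!Nat.beq δ.1 0 || Nat.ble (96 + δ.2.2) (6 * δ.2.1 + 28)))
    (K := [(0, 5, 8, 44), (11, 0, 4, 47), (1, 1, 5, 36), (8, 8, 5, 99), (6, 11, 3, 88), (7, 5, 4,
      86), (7, 8, 4, 98), (8, 4, 5, 92), (5, 2, 0, 60), (12, 9, 2, 120), (8, 0, 1, 78), (12,
      7, 7, 137), (10, 7, 10, 138)])
    (by norm_num) (by norm_num) (by norm_num) (by decide +kernel) (by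
      intro a b c
      simp only [Nat.ble_eq, Nat.beq_eq, Bool.and_eq_true, Bool.or_eq_true, bnot_iff]
      omega)



/-! ## All degrees, by slicing -/

def Tet (d a b c : ℤ) : Prop := 0 ≤ a ∧ 0 ≤ b ∧ 0 ≤ c ∧ a + b + c ≤ d
def ColA (d a b c : ℤ) : Prop := 0 ≤ a ∧ 0 ≤ b ∧ 0 ≤ c ∧ a < 4 ∧ b < 10 ∧ a + b + c ≤ d
def SlabB (d a b c : ℤ) : Prop := 0 ≤ a ∧ 0 ≤ b ∧ 0 ≤ c ∧ b < 10 ∧ a + b + c ≤ d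
def ColB (d a b c : ℤ) : Prop := 0 ≤ a ∧ 0 ≤ b ∧ 0 ≤ c ∧ a < 5 ∧ b < 8 ∧ a + b + c ≤ d
def Slab (d a b c : ℤ) : Prop := 0 ≤ a ∧ 0 ≤ b ∧ 0 ≤ c ∧ a < 5 ∧ a + b + c ≤ d
def RY (s d a b c : ℤ) : Prop := 0 ≤ a ∧ 0 ≤ b ∧ 0 ≤ c ∧ a < 5 ∧ a + b + c ≤ d ∧
  ¬ (a = 4 ∧ 6 * (d - 4) - s ≤ 6 * b - c)
def RX (s d a b c : ℤ) : Prop := 0 ≤ a ∧ 0 ≤ b ∧ 0 ≤ c ∧ a + b + c ≤ d + 1 ∧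
  (a = 0 → 6 * (d + 1) - s ≤ 6 * b - c)

theorem SeaP.sh {P P' : ℤ → ℤ → ℤ → Prop} (h : SeaP P) (s t r : ℤ)
    (hP : P' = fun a b c => P (a - s) (b - t) (c - r)) : SeaP P' :=
  h.shift s t r fun a b c => by rw [hP]

theorem FullP.sh {P P' : ℤ → ℤ → ℤ → Prop} (h : FullP P) (s t r : ℤ)
    (hP : P' = fun a b c => P (a - s) (b - t) (c - r)) : FullP P' :=
  h.shift s t r fun a b c => by rw [hP]

theorem sea_ColA : ∀ k : ℕ, SeaP (ColA (2 * k + 11))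
  | 0 => sea_colA11
  | 1 => sea_colA13
  | k + 2 => by
    refine SeaP.cut 0 0 1 4 (by omega) sea_boxA ((sea_ColA k).sh 0 0 4 rfl) ?_ ?_ <;>
    · intro a b c
      simp only [ColA]
      omega

theorem sea_SlabB : ∀ k : ℕ, SeaP (SlabB (2 * k + 9))
  | 0 => sea_T9.shift 0 0 0 (by intro a b c; simp only [SlabB]; omega)
  | 1 => sea_slabB11
  | k + 2 => by
    refine SeaP.cut 1 0 0 4 (by omega) (sea_ColA (k + 1)) ((sea_SlabB k).sh 4 0 0 rfl) ?_ ?_ <;>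
    · intro a b c
      simp only [ColA, SlabB]
      omega

theorem full_T13 : FullP (Tet 13) := by
  refine FullP.cut 1 0 0 4 (by omega) sea_slab13 (full_T9.sh 4 0 0 rfl) ?_ ?_ <;>
  · intro a b c
    simp only [Tet]
    omega

theorem full_T17 : FullP (Tet 17) := by
  refine FullP.cut 1 0 0 4 (by omega) sea_slab17 (full_T13.sh 4 0 0 rfl) ?_ ?_ <;>
  · intro a b c
    simp only [Tet]
    omega

theorem sea_T13 : SeaP (Tet 13) := by
  refine SeaP.cut 1 0 0 4 (by omega) sea_slab13 (sea_T9.sh 4 0 0 rfl) ?_ ?_ <;>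
  · intro a b c
    simp only [Tet]
    omega

theorem sea_T17 : SeaP (Tet 17) := by
  refine SeaP.cut 1 0 0 4 (by omega) sea_slab17 (sea_T13.sh 4 0 0 rfl) ?_ ?_ <;>
  · intro a b c
    simp only [Tet]
    omega

/-- All odd degrees. -/
theorem full_odd : ∀ k : ℕ, FullP (Tet (2 * k + 9))
  | 0 => full_T9
  | 1 => full_T11
  | 2 => full_T13
  | 3 => full_T15
  | 4 => full_T17
  | k + 5 => by
    refine FullP.cut 0 1 0 10 (by omega) (sea_SlabB (k + 5)) ((full_odd k).sh 0 10 0 rfl) ?_ ?_ <;>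
    · intro a b c
      simp only [Tet, SlabB]
      omega

theorem sea_odd : ∀ k : ℕ, (k % 5 = 0 ∨ k % 5 = 2 ∨ k % 5 = 4) → SeaP (Tet (2 * k + 9))
  | 0, _ => sea_T9
  | 1, h => by omega
  | 2, _ => sea_T13
  | 3, h => by omega
  | 4, _ => sea_T17
  | k + 5, h => by
    refine SeaP.cut 0 1 0 10 (by omega) (sea_SlabB (k + 5))
      ((sea_odd k (by omega)).sh 0 10 0 rfl) ?_ ?_ <;>
    · intro a b c
      simp only [Tet, SlabB]
      omega

theorem sea_ColB : ∀ k : ℕ, SeaP (ColB (2 * k + 10))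
  | 0 => sea_colB10
  | 1 => sea_colB12
  | k + 2 => by
    refine SeaP.cut 0 0 1 4 (by omega) sea_boxB ((sea_ColB k).sh 0 0 4 rfl) ?_ ?_ <;>
    · intro a b c
      simp only [ColB]
      omega

theorem full_Slab : ∀ k : ℕ, k % 4 ≠ 2 → FullP (Slab (2 * k + 10))
  | 0, _ => full_slab10
  | 1, _ => full_slab12
  | 2, h => by omega
  | 3, _ => full_slab16
  | k + 4, h => by
    refine FullP.cut 0 1 0 8 (by omega) (sea_ColB (k + 4))
      ((full_Slab k (by omega)).sh 0 8 0 rfl) ?_ ?_ <;>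
    · intro a b c
      simp only [Slab, ColB]
      omega

theorem sea_Slab : ∀ k : ℕ, SeaP (Slab (8 * k + 14))
  | 0 => sea_slab14
  | k + 1 => by
    refine SeaP.cut 0 1 0 8 (by omega) ((sea_ColB (4 * k + 6)))
      ((sea_Slab k).sh 0 8 0 rfl) ?_ ?_ <;>
    · intro a b c
      simp only [Slab, ColB]
      omega

theorem sea_RY_step {s e : ℤ} (k : ℕ) (hs : s ≤ 28) (hk : (2 * k + 10 : ℤ) = e + 8) (he : 10 ≤ e)
    (h : SeaP (RY s e)) : SeaP (RY s (e + 8)) := by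
  refine SeaP.cut 0 1 0 8 (by omega) (sea_ColB k) (h.sh 0 8 0 rfl) ?_ ?_ <;>
  · intro a b c
    simp only [RY, ColB]
    omega

theorem sea_Y21' : ∀ k : ℕ, SeaP (RY 21 (8 * k + 10))
  | 0 => sea_Y21
  | k + 1 => by
    have := sea_RY_step (4 * k + 4) (by omega) (by push_cast; ring) (by omega) (sea_Y21' k)
    convert this using 1
    push_cast; ring_nf

theorem sea_Y28' : ∀ k : ℕ, SeaP (RY 28 (8 * k + 12))
  | 0 => sea_Y28
  | k + 1 => by
    have := sea_RY_step (4 * k + 5) (by omega) (by push_cast; ring) (by omega) (sea_Y28' k)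
    convert this using 1
    push_cast; ring_nf

theorem sea_Y13' : ∀ k : ℕ, SeaP (RY 13 (8 * k + 16))
  | 0 => sea_Y13
  | k + 1 => by
    have := sea_RY_step (4 * k + 7) (by omega) (by push_cast; ring) (by omega) (sea_Y13' k)
    convert this using 1
    push_cast; ring_nf

theorem full_RX_step {s e : ℤ} (k : ℕ) (hs : s ≤ 28) (hk : (2 * k + 9 : ℤ) = e + 10) (he : 11 ≤ e)
    (h : FullP (RX s e)) : FullP (RX s (e + 10)) := by
  refine FullP.cut 0 1 0 10 (by omega) ((sea_SlabB k).sh 1 0 0 rfl) (h.sh 0 10 0 rfl) ?_ ?_ <;>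
  · intro a b c
    simp only [RX, SlabB]
    omega

theorem full_RX11 {s : ℤ} (hs : s ≤ 28) (h : FullP (RX s 11)) :
    ∀ k : ℕ, FullP (RX s (10 * k + 11))
  | 0 => h
  | k + 1 => by
    have := full_RX_step (5 * k + 6) hs (by push_cast; ring) (by omega) (full_RX11 hs h k)
    convert this using 1
    push_cast; ring_nf

theorem full_RX15 {s : ℤ} (hs : s ≤ 28) (h : FullP (RX s 15)) :
    ∀ k : ℕ, FullP (RX s (10 * k + 15))
  | 0 => h
  | k + 1 => by
    have := full_RX_step (5 * k + 8) hs (by push_cast; ring) (by omega) (full_RX15 hs h k)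
    convert this using 1
    push_cast; ring_nf

/-- The slanted cut of an even simplex. -/
theorem full_glue {s e : ℤ} (hs : 0 ≤ s) (hs' : s ≤ 28) (he : 16 ≤ e) (hY : SeaP (RY s e))
    (hX : FullP (RX s (e - 5))) : FullP (Tet e) := by
  have key : ∀ a b c : ℤ, Tet e a b c →
      (8 * e * a + 6 * b + (-1) * c < 4 * (8 * e) + (6 * (e - 4) - s) ↔
        a < 5 ∧ ¬ (a = 4 ∧ 6 * (e - 4) - s ≤ 6 * b - c)) := by
    rintro a b c ⟨h1, h2, h3, h4⟩
    rcases lt_trichotomy a 4 with h | h | h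
    · have : e * a ≤ e * 3 := mul_le_mul_of_nonneg_left (by omega) (by omega)
      constructor
      · intro _; omega
      · intro _; nlinarith
    · subst h
      constructor
      · intro h; refine ⟨by omega, ?_⟩; rintro ⟨_, h'⟩; linarith
      · rintro ⟨_, h'⟩
        have : ¬ (6 * (e - 4) - s ≤ 6 * b - c) := fun h => h' ⟨rfl, h⟩
        linarith
    · have : e * 5 ≤ e * a := mul_le_mul_of_nonneg_left (by omega) (by omega)
      constructor
      · intro h; exfalso; nlinarith
      · intro h; omega
  refine FullP.cut (8 * e) 6 (-1) (4 * (8 * e) + (6 * (e - 4) - s)) (by omega) hY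
    (hX.sh 4 0 0 rfl) ?_ ?_
  · intro a b c
    by_cases hT : Tet e a b c
    · rw [key a b c hT]
      simp only [Tet, RY] at *
      omega
    · simp only [Tet, RY] at *
      omega
  · intro a b c
    by_cases hT : Tet e a b c
    · rw [key a b c hT]
      simp only [Tet, RX] at *
      omega
    · simp only [Tet, RX] at *
      omega

theorem full_even_sea (k j : ℕ) (h : (8 * k + 14 : ℤ) = 2 * j + 9 + 5) : FullP (Tet (8 * k + 14)) := by
  refine FullP.cut 1 0 0 5 (by omega) (sea_Slab k) ((full_odd j).sh 5 0 0 rfl) ?_ ?_ <;>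
  · intro a b c
    simp only [Slab, Tet]
    omega

theorem full_even_full (k : ℕ) (hk : (k + 2) % 4 ≠ 2)
    (h : k % 5 = 0 ∨ k % 5 = 2 ∨ k % 5 = 4) : FullP (Tet (2 * k + 14)) := by
  refine FullP.cut' 1 0 0 5 (by omega) (full_Slab (k + 2) hk) ((sea_odd k h).sh 5 0 0 rfl) ?_ ?_ <;>
  · intro a b c
    simp only [Slab, Tet]
    omega

theorem full_even (k : ℕ) : FullP (Tet (2 * k + 14)) := by
  by_cases h6 : (k + 2) % 4 = 2
  · have := full_even_sea (k / 4) k (by omega)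
    convert this using 1
    congr 1
    omega
  by_cases h5 : k % 5 = 0 ∨ k % 5 = 2 ∨ k % 5 = 4
  · exact full_even_full k h6 h5
  have hX11 : ∀ s : ℤ, s ≤ 28 → FullP (RX s 11) → FullP (RX s 15) →
      FullP (RX s ((2 * k + 14 : ℤ) - 5)) := by
    intro s hs h11 h15
    by_cases h1 : k % 5 = 1
    · convert full_RX11 hs h11 (k / 5) using 2
      omega
    · convert full_RX15 hs h15 (k / 5) using 2
      omega
  have h3 : k % 4 = 1 ∨ k % 4 = 2 ∨ k % 4 = 3 := by omega
  rcases h3 with h | h | h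
  · refine full_glue (s := 13) (by omega) (by omega) (by omega) ?_
      (hX11 13 (by omega) full_X13_11 full_X13_15)
    convert sea_Y13' (k / 4) using 2
    omega
  · refine full_glue (s := 21) (by omega) (by omega) (by omega) ?_
      (hX11 21 (by omega) full_X21_11 full_X21_15)
    convert sea_Y21' (k / 4 + 1) using 2
    push_cast
    omega
  · refine full_glue (s := 28) (by omega) (by omega) (by omega) ?_
      (hX11 28 (by omega) full_X28_11 full_X28_15)
    convert sea_Y28' (k / 4 + 1) using 2
    push_cast
    omega

theorem full_Tet (d : ℕ) (hd : 9 ≤ d) : FullP (Tet d) := by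
  rcases Nat.even_or_odd' d with ⟨k, rfl | rfl⟩
  · by_cases h : 7 ≤ k
    · convert full_even (k - 7) using 2
      omega
    · have : k = 5 ∨ k = 6 := by omega
      rcases this with rfl | rfl
      · exact full_T10
      · exact full_T12
  · convert full_odd (k - 4) using 2
    omega


/-! ## Derivatives of monomials -/

theorem pderiv_pow_monomial (i : Fin 4) (n : ℕ) (s : Fin 4 →₀ ℕ) (r : ℚ) :
    ((MvPolynomial.pderiv i).toLinearMap ^ n : Module.End ℚ (MvPolynomial (Fin 4) ℚ))
      (MvPolynomial.monomial s r) =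
      MvPolynomial.monomial (s - Finsupp.single i n) (r * (s i).descFactorial n) := by
  induction n with
  | zero => simp
  | succ n ih =>
    rw [pow_succ', Module.End.mul_apply, ih]
    change MvPolynomial.pderiv i _ = _
    rw [MvPolynomial.pderiv_monomial]
    have h1 : s - Finsupp.single i n - Finsupp.single i 1 = s - Finsupp.single i (n + 1) := by
      rw [tsub_tsub, ← Finsupp.single_add]
    rw [h1, Nat.descFactorial_succ]
    congr 1
    simp
    ring

theorem aeval_diffOp_monomial (q : Fin 4 → ℚ) (ν : Fin 4 → ℕ) (s : Fin 4 →₀ ℕ) (r : ℚ) :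
    MvPolynomial.aeval q (diffOp ν (MvPolynomial.monomial s r)) =
      r * ∏ i, (((s i).descFactorial (ν i) : ℚ) * q i ^ (s i - ν i)) := by
  simp only [diffOp, Module.End.mul_apply, pderiv_pow_monomial]
  rw [MvPolynomial.aeval_monomial, Finsupp.prod_fintype _ _ (by simp), Fin.prod_univ_four,
    Fin.prod_univ_four]
  simp
  ring

/-- Falling factorial function. -/
def dsc (n : ℕ) (x : ℚ) : ℚ := ∏ t ∈ Finset.range n, (x - t)

theorem dsc_succ (n : ℕ) (x : ℚ) : dsc (n + 1) x = dsc n x * (x - n) := by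
  rw [dsc, Finset.prod_range_succ, dsc]

theorem cast_desc (x n : ℕ) : (x.descFactorial n : ℚ) = dsc n x := by
  induction n with
  | zero => simp [dsc]
  | succ n ih =>
    rw [Nat.descFactorial_succ, dsc_succ, ← ih, Nat.cast_mul]
    rcases le_or_gt n x with h | h
    · rw [Nat.cast_sub h]; ring
    · rw [Nat.descFactorial_eq_zero_iff_lt.2 h]; simp

def dmon (i j k : ℕ) (δ : Z3) : ℚ := dsc i δ.1 * dsc j δ.2.1 * dsc k δ.2.2

def PolD (m : ℕ) : Submodule ℚ (Z3 → ℚ) :=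
  Submodule.span ℚ {f | ∃ i j k : ℕ, i + j + k < m ∧ f = dmon i j k}

theorem dmon_mem {m i j k : ℕ} (h : i + j + k < m) : dmon i j k ∈ PolD m :=
  Submodule.subset_span ⟨i, j, k, h, rfl⟩

theorem PolD_mul_x {m : ℕ} {f : Z3 → ℚ} (hf : f ∈ PolD m) :
    (fun δ => (δ.1 : ℚ) * f δ) ∈ PolD (m + 1) := by
  induction hf using Submodule.span_induction with
  | mem f hf =>
    obtain ⟨i, j, k, h, rfl⟩ := hf
    have : (fun δ : Z3 => (δ.1 : ℚ) * dmon i j k δ) =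
        dmon (i + 1) j k + (i : ℚ) • dmon i j k := by
      funext δ; simp only [dmon, dsc_succ, Pi.add_apply, Pi.smul_apply, smul_eq_mul]; ring
    rw [this]
    exact add_mem (dmon_mem (by omega)) (Submodule.smul_mem _ _ (dmon_mem (by omega)))
  | zero => convert (PolD (m + 1)).zero_mem using 1; funext δ; simp
  | add f g _ _ hf hg => convert add_mem hf hg using 1; funext δ; simp [mul_add]
  | smul a f _ hf =>
    convert Submodule.smul_mem _ a hf using 1
    funext δ; simp only [Pi.smul_apply, smul_eq_mul]; ring

theorem PolD_mul_y {m : ℕ} {f : Z3 → ℚ} (hf : f ∈ PolD m) :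
    (fun δ => (δ.2.1 : ℚ) * f δ) ∈ PolD (m + 1) := by
  induction hf using Submodule.span_induction with
  | mem f hf =>
    obtain ⟨i, j, k, h, rfl⟩ := hf
    have : (fun δ : Z3 => (δ.2.1 : ℚ) * dmon i j k δ) =
        dmon i (j + 1) k + (j : ℚ) • dmon i j k := by
      funext δ; simp only [dmon, dsc_succ, Pi.add_apply, Pi.smul_apply, smul_eq_mul]; ring
    rw [this]
    exact add_mem (dmon_mem (by omega)) (Submodule.smul_mem _ _ (dmon_mem (by omega)))
  | zero => convert (PolD (m + 1)).zero_mem using 1; funext δ; simp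
  | add f g _ _ hf hg => convert add_mem hf hg using 1; funext δ; simp [mul_add]
  | smul a f _ hf =>
    convert Submodule.smul_mem _ a hf using 1
    funext δ; simp only [Pi.smul_apply, smul_eq_mul]; ring

theorem PolD_mul_z {m : ℕ} {f : Z3 → ℚ} (hf : f ∈ PolD m) :
    (fun δ => (δ.2.2 : ℚ) * f δ) ∈ PolD (m + 1) := by
  induction hf using Submodule.span_induction with
  | mem f hf =>
    obtain ⟨i, j, k, h, rfl⟩ := hf
    have : (fun δ : Z3 => (δ.2.2 : ℚ) * dmon i j k δ) =
        dmon i j (k + 1) + (k : ℚ) • dmon i j k := by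
      funext δ; simp only [dmon, dsc_succ, Pi.add_apply, Pi.smul_apply, smul_eq_mul]; ring
    rw [this]
    exact add_mem (dmon_mem (by omega)) (Submodule.smul_mem _ _ (dmon_mem (by omega)))
  | zero => convert (PolD (m + 1)).zero_mem using 1; funext δ; simp
  | add f g _ _ hf hg => convert add_mem hf hg using 1; funext δ; simp [mul_add]
  | smul a f _ hf =>
    convert Submodule.smul_mem _ a hf using 1
    funext δ; simp only [Pi.smul_apply, smul_eq_mul]; ring

theorem PolD_mono {m n : ℕ} (h : m ≤ n) : PolD m ≤ PolD n := by
  apply Submodule.span_mono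
  rintro f ⟨i, j, k, hh, rfl⟩
  exact ⟨i, j, k, by omega, rfl⟩

theorem mon_mem_PolD (i j k : ℕ) : mon i j k ∈ PolD (i + j + k + 1) := by
  induction i with
  | succ i ih =>
    convert PolD_mono (show i + j + k + 1 + 1 ≤ i + 1 + j + k + 1 by omega) (PolD_mul_x ih) using 1
    funext δ; simp only [mon]; ring
  | zero =>
    induction j with
    | succ j ih =>
      convert PolD_mono (show 0 + j + k + 1 + 1 ≤ 0 + (j + 1) + k + 1 by omega)
        (PolD_mul_y ih) using 1
      funext δ; simp only [mon]; ring
    | zero =>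
      induction k with
      | succ k ih =>
        convert PolD_mono (show 0 + 0 + k + 1 + 1 ≤ 0 + 0 + (k + 1) + 1 by omega)
          (PolD_mul_z ih) using 1
        funext δ; simp only [mon]; ring
      | zero =>
        convert dmon_mem (m := 1) (i := 0) (j := 0) (k := 0) (by omega) using 1
        funext δ; simp [mon, dmon, dsc]

/-- Conversely the conditions given by derivatives are polynomial. -/
theorem desc_mem_Pol (d : ℕ) (h i j k : ℕ) :
    (fun δ : Z3 => dsc h ((d : ℚ) - δ.1 - δ.2.1 - δ.2.2) * dmon i j k δ) ∈
      Pol (h + i + j + k + 1) := by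
  induction h with
  | succ h ih =>
    have := Pol_mul_affine ih (-1) (-1) (-1) ((d : ℚ) - h)
    convert Pol_mono (show h + i + j + k + 1 + 1 ≤ h + 1 + i + j + k + 1 by omega) this using 1
    funext δ; simp only [dsc_succ]; ring
  | zero =>
    induction i with
    | succ i ih =>
      have := Pol_mul_affine ih 1 0 0 (-(i : ℚ))
      convert Pol_mono (show 0 + i + j + k + 1 + 1 ≤ 0 + (i + 1) + j + k + 1 by omega) this using 1
      funext δ; simp only [dmon, dsc_succ]; ring
    | zero =>
      induction j with
      | succ j ih =>
        have := Pol_mul_affine ih 0 1 0 (-(j : ℚ))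
        convert Pol_mono (show 0 + 0 + j + k + 1 + 1 ≤ 0 + 0 + (j + 1) + k + 1 by omega) this
          using 1
        funext δ; simp only [dmon, dsc_succ]; ring
      | zero =>
        induction k with
        | succ k ih =>
          have := Pol_mul_affine ih 0 0 1 (-(k : ℚ))
          convert Pol_mono (show 0 + 0 + 0 + k + 1 + 1 ≤ 0 + 0 + 0 + (k + 1) + 1 by omega) this
            using 1
          funext δ; simp only [dmon, dsc_succ]; ring
        | zero =>
          convert one_mem_Pol using 1
          funext δ; simp [dmon, dsc]

/-! ## Linear algebra -/

/-- The index set of the conditions at a point of multiplicity `m ≤ 4`. -/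
abbrev IM (m : ℕ) := {t : Fin 4 × Fin 4 × Fin 4 // t.1.1 + t.2.1.1 + t.2.2.1 < m}

theorem card_IM {m : ℕ} (hm : m ≤ 4) : Fintype.card (IM m) = (m + 2).choose 3 := by
  interval_cases m <;> decide +kernel

noncomputable def condMap (D : Finset Z3) (mp : ℕ × Q3) : (D → ℚ) →ₗ[ℚ] (IM mp.1 → ℚ) where
  toFun g t := ∑ δ : D, g δ * (mon t.1.1.1 t.1.2.1.1 t.1.2.2.1 δ.1 * chr mp.2 δ.1)
  map_add' g h := by funext t; simp [add_mul, Finset.sum_add_distrib]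
  map_smul' a g := by funext t; simp [Finset.mul_sum, mul_assoc]

noncomputable def KL (D : Finset Z3) (l : List (ℕ × Q3)) : Submodule ℚ (D → ℚ) :=
  ⨅ mp ∈ l, LinearMap.ker (condMap D mp)

theorem mem_KL {D : Finset Z3} {l : List (ℕ × Q3)} {g : D → ℚ} (hl : ∀ mp ∈ l, mp.1 ≤ 4) :
    g ∈ KL D l ↔ ∀ mp ∈ l, ∀ i j k : ℕ, i + j + k < mp.1 →
      ∑ δ : D, g δ * (mon i j k δ.1 * chr mp.2 δ.1) = 0 := by
  simp only [KL, Submodule.mem_iInf, LinearMap.mem_ker]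
  refine forall₂_congr fun mp hmp => ?_
  have h4 := hl mp hmp
  constructor
  · intro h i j k hh
    exact congrFun h ⟨(⟨i, by omega⟩, ⟨j, by omega⟩, ⟨k, by omega⟩), hh⟩
  · intro h
    funext t
    exact h _ _ _ t.2

theorem finrank_le_inf {D : Finset Z3} (S : Submodule ℚ (D → ℚ)) {mp : ℕ × Q3} (h : mp.1 ≤ 4) :
    Module.finrank ℚ S ≤
      Module.finrank ℚ (S ⊓ LinearMap.ker (condMap D mp) : Submodule ℚ (D → ℚ)) +
        (mp.1 + 2).choose 3 := by
  have h1 := LinearMap.finrank_range_add_finrank_ker (condMap D mp ∘ₗ S.subtype)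
  have h2 := Submodule.finrank_le (LinearMap.range (condMap D mp ∘ₗ S.subtype))
  rw [Module.finrank_fintype_fun_eq_card, card_IM h] at h2
  rw [LinearMap.ker_comp] at h1
  have h3 : Module.finrank ℚ (Submodule.comap S.subtype (LinearMap.ker (condMap D mp))) =
      Module.finrank ℚ (S ⊓ LinearMap.ker (condMap D mp) : Submodule ℚ (D → ℚ)) := by
    rw [← Submodule.map_comap_subtype]
    exact (Submodule.equivMapOfInjective _ S.injective_subtype _).finrank_eq
  omega

theorem finrank_le_KL {D : Finset Z3} (S : Submodule ℚ (D → ℚ)) (l : List (ℕ × Q3))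
    (hl : ∀ mp ∈ l, mp.1 ≤ 4) :
    Module.finrank ℚ S ≤ Module.finrank ℚ (S ⊓ KL D l : Submodule ℚ (D → ℚ)) +
      (l.map fun mp => (mp.1 + 2).choose 3).sum := by
  induction l generalizing S with
  | nil =>
    have : KL D [] = ⊤ := by
      rw [eq_top_iff]
      intro g _
      simp only [KL, Submodule.mem_iInf, List.not_mem_nil, false_imp_iff, implies_true]
    rw [this, inf_top_eq]; simp
  | cons mp l ih =>
    have h1 := finrank_le_inf S (hl mp (by simp))
    have h2 := ih (S ⊓ LinearMap.ker (condMap D mp)) fun mp h => hl mp (by simp [h])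
    have h3 : S ⊓ KL D (mp :: l) = S ⊓ LinearMap.ker (condMap D mp) ⊓ KL D l := by
      ext g
      simp only [KL, Submodule.mem_inf, Submodule.mem_iInf, List.mem_cons, forall_eq_or_imp]
      tauto
    rw [h3, List.map_cons, List.sum_cons]
    omega

theorem exists_list {α β : Type*} (f : α → β) (l : List β) :
    ∀ Q : Multiset α, Q.map f = (l : Multiset β) → ∃ q : List α, (q : Multiset α) = Q ∧
      q.map f = l := by
  classical
  induction l with
  | nil => intro Q h; exact ⟨[], by simpa [eq_comm] using h, rfl⟩
  | cons b l ih =>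
    intro Q h
    rw [← Multiset.cons_coe, ← Multiset.map_eq_cons] at h
    obtain ⟨a, ha, rfl, h⟩ := h
    obtain ⟨q, h1, h2⟩ := ih _ h
    refine ⟨a :: q, ?_, by simp [h2]⟩
    rw [← Multiset.cons_coe, h1, Multiset.cons_erase ha]


/-! ## The space of polynomials as a space of functions on lattice points -/

noncomputable def exD (d : ℕ) (δ : Z3) : Fin 4 →₀ ℕ := Finsupp.equivFunOnFinite.symm
  ![((d : ℤ) - δ.1 - δ.2.1 - δ.2.2).toNat, δ.1.toNat, δ.2.1.toNat, δ.2.2.toNat]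

theorem exD_zero (d : ℕ) (δ : Z3) : exD d δ 0 = ((d : ℤ) - δ.1 - δ.2.1 - δ.2.2).toNat := rfl
theorem exD_one (d : ℕ) (δ : Z3) : exD d δ 1 = δ.1.toNat := rfl
theorem exD_two (d : ℕ) (δ : Z3) : exD d δ 2 = δ.2.1.toNat := rfl
theorem exD_three (d : ℕ) (δ : Z3) : exD d δ 3 = δ.2.2.toNat := rfl

theorem exD_inj {d : ℕ} {δ ε : Z3} (h : Tet d δ.1 δ.2.1 δ.2.2) (h' : Tet d ε.1 ε.2.1 ε.2.2)
    (he : exD d δ = exD d ε) : δ = ε := by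
  have h1 := DFunLike.congr_fun he 1
  have h2 := DFunLike.congr_fun he 2
  have h3 := DFunLike.congr_fun he 3
  rw [exD_one, exD_one] at h1
  rw [exD_two, exD_two] at h2
  rw [exD_three, exD_three] at h3
  obtain ⟨a, b, c⟩ := δ
  obtain ⟨a', b', c'⟩ := ε
  simp only [Tet] at *
  ext <;> simp only <;> omega

theorem exD_degree {d : ℕ} {δ : Z3} (h : Tet d δ.1 δ.2.1 δ.2.2) : ∑ i, exD d δ i = d := by
  rw [Fin.sum_univ_four, exD_zero, exD_one, exD_two, exD_three]
  simp only [Tet] at h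
  omega

theorem exists_exD {d : ℕ} {s : Fin 4 →₀ ℕ} (hs : ∑ i, s i = d) :
    ∃ δ : Z3, Tet d δ.1 δ.2.1 δ.2.2 ∧ exD d δ = s := by
  rw [Fin.sum_univ_four] at hs
  refine ⟨((s 1 : ℤ), (s 2 : ℤ), (s 3 : ℤ)), ?_, ?_⟩
  · simp only [Tet]; omega
  · ext i
    fin_cases i
    · change exD d _ 0 = _
      rw [exD_zero]
      simp only [Fin.zero_eta]
      omega
    · change exD d _ 1 = _
      rw [exD_one]; simp
    · change exD d _ 2 = _
      rw [exD_two]; simp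
    · change exD d _ 3 = _
      rw [exD_three]; simp

theorem card_Tet {d : ℕ} {D : Finset Z3} (hD : ∀ a b c, (a, b, c) ∈ D ↔ Tet d a b c) :
    D.card = (d + 3).choose 3 := by
  have h : D.card = ((Finset.univ : Finset (Fin 4)).finsuppAntidiag d).card := by
    apply Finset.card_bij (fun δ _ => exD d δ)
    · intro δ hδ
      rw [Finset.mem_finsuppAntidiag]
      exact ⟨exD_degree ((hD _ _ _).1 hδ), Finset.subset_univ _⟩
    · intro δ hδ ε hε he
      exact exD_inj ((hD _ _ _).1 hδ) ((hD _ _ _).1 hε) he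
    · intro s hs
      rw [Finset.mem_finsuppAntidiag] at hs
      obtain ⟨δ, h1, h2⟩ := exists_exD hs.1
      exact ⟨δ, (hD _ _ _).2 h1, h2⟩
  rw [h, Finset.card_finsuppAntidiag_nat_eq_choose, Finset.card_univ, Fintype.card_fin]
  rw [show 4 + d - 1 = d + 3 by omega]
  exact (Nat.choose_symm_add).trans rfl

noncomputable def polyMap (d : ℕ) (D : Finset Z3) : (D → ℚ) →ₗ[ℚ] MvPolynomial (Fin 4) ℚ :=
  ∑ δ : D, MvPolynomial.monomial (exD d δ.1) ∘ₗ LinearMap.proj δ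

theorem polyMap_apply (d : ℕ) (D : Finset Z3) (g : D → ℚ) :
    polyMap d D g = ∑ δ : D, MvPolynomial.monomial (exD d δ.1) (g δ) := by
  simp [polyMap]

theorem coeff_polyMap {d : ℕ} {D : Finset Z3} (hD : ∀ a b c, (a, b, c) ∈ D ↔ Tet d a b c)
    (g : D → ℚ) (δ : D) : MvPolynomial.coeff (exD d δ.1) (polyMap d D g) = g δ := by
  classical
  rw [polyMap_apply, MvPolynomial.coeff_sum, Finset.sum_eq_single δ]
  · rw [MvPolynomial.coeff_monomial, if_pos rfl]
  · intro ε _ hne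
    rw [MvPolynomial.coeff_monomial, if_neg]
    intro he
    exact hne (Subtype.ext (exD_inj ((hD _ _ _).1 ε.2) ((hD _ _ _).1 δ.2) he))
  · simp

theorem polyMap_inj {d : ℕ} {D : Finset Z3} (hD : ∀ a b c, (a, b, c) ∈ D ↔ Tet d a b c) :
    Function.Injective (polyMap d D) := by
  intro g h he
  funext δ
  rw [← coeff_polyMap hD g δ, he, coeff_polyMap hD h δ]

theorem degree_eq_sum4 (s : Fin 4 →₀ ℕ) : s.degree = ∑ i, s i := by
  rw [Finsupp.degree_eq_sum]

theorem polyMap_hom {d : ℕ} {D : Finset Z3} (hD : ∀ a b c, (a, b, c) ∈ D ↔ Tet d a b c)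
    (g : D → ℚ) : polyMap d D g ∈ MvPolynomial.homogeneousSubmodule (Fin 4) ℚ d := by
  rw [polyMap_apply]
  refine Submodule.sum_mem _ fun δ _ => ?_
  apply MvPolynomial.isHomogeneous_monomial
  rw [degree_eq_sum4, exD_degree ((hD _ _ _).1 δ.2)]

theorem hom_le_range {d : ℕ} {D : Finset Z3} (hD : ∀ a b c, (a, b, c) ∈ D ↔ Tet d a b c) :
    MvPolynomial.homogeneousSubmodule (Fin 4) ℚ d ≤ LinearMap.range (polyMap d D) := by
  intro F hF
  refine ⟨fun δ => MvPolynomial.coeff (exD d δ.1) F, ?_⟩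
  ext s
  by_cases hs : s.degree = d
  · rw [degree_eq_sum4] at hs
    obtain ⟨δ, h1, rfl⟩ := exists_exD hs
    exact coeff_polyMap hD _ ⟨δ, (hD _ _ _).2 h1⟩
  · rw [((MvPolynomial.mem_homogeneousSubmodule _ _).1 hF).coeff_eq_zero hs,
      ((MvPolynomial.mem_homogeneousSubmodule _ _).1 (polyMap_hom hD _)).coeff_eq_zero hs]

def ptOf (p : Q3) : Fin 4 → ℚ := ![1, p.1, p.2.1, p.2.2]

theorem desc_mul_pow {x : ℚ} (hx : x ≠ 0) (a : ℤ) (ha : 0 ≤ a) (n : ℕ) :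
    (a.toNat.descFactorial n : ℚ) * x ^ (a.toNat - n) = dsc n a * x ^ a * x ^ (-(n : ℤ)) := by
  lift a to ℕ using ha
  rw [Int.toNat_natCast, cast_desc, Int.cast_natCast]
  rcases le_or_gt n a with h | h
  · rw [mul_assoc, ← zpow_add₀ hx, ← Int.sub_eq_add_neg, ← Nat.cast_sub h, zpow_natCast]
  · rw [← cast_desc, Nat.descFactorial_eq_zero_iff_lt.2 h]; simp

theorem aeval_diffOp_polyMap {d : ℕ} {D : Finset Z3}
    (hD : ∀ a b c, (a, b, c) ∈ D ↔ Tet d a b c) {p : Q3} (hp : tor p) (ν : Fin 4 → ℕ)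
    (g : D → ℚ) :
    MvPolynomial.aeval (ptOf p) (diffOp ν (polyMap d D g)) =
      chr p (-(ν 1 : ℤ), -(ν 2 : ℤ), -(ν 3 : ℤ)) * ∑ δ : D, g δ *
        (dsc (ν 0) ((d : ℚ) - δ.1.1 - δ.1.2.1 - δ.1.2.2) * dmon (ν 1) (ν 2) (ν 3) δ.1 *
          chr p δ.1) := by
  rw [polyMap_apply, map_sum, map_sum, Finset.mul_sum]
  refine Finset.sum_congr rfl fun δ _ => ?_
  obtain ⟨⟨a, b, c⟩, hδ⟩ := δ
  obtain ⟨ha, hb, hc, hd⟩ := (hD _ _ _).1 hδ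
  obtain ⟨p1, p2, p3⟩ := hp
  rw [aeval_diffOp_monomial, Fin.prod_univ_four, exD_zero, exD_one, exD_two, exD_three]
  have e0 : ptOf p 0 = 1 := rfl
  have e1 : ptOf p 1 = p.1 := rfl
  have e2 : ptOf p 2 = p.2.1 := rfl
  have e3 : ptOf p 3 = p.2.2 := rfl
  rw [e0, e1, e2, e3]
  simp only
  rw [desc_mul_pow one_ne_zero _ (by omega), desc_mul_pow p1 a ha, desc_mul_pow p2 b hb,
    desc_mul_pow p3 c hc]
  simp only [one_zpow, mul_one, chr, dmon]
  push_cast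
  ring

theorem mem_vanishing_iff {d : ℕ} {D : Finset Z3}
    (hD : ∀ a b c, (a, b, c) ∈ D ↔ Tet d a b c) {p : Q3} (hp : tor p) (m : ℕ) (g : D → ℚ) :
    polyMap d D g ∈ vanishingSpace m (ptOf p) ↔ ∀ i j k : ℕ, i + j + k < m →
      ∑ δ : D, g δ * (mon i j k δ.1 * chr p δ.1) = 0 := by
  have h0 : polyMap d D g ∈ vanishingSpace m (ptOf p) ↔ ∀ ν : Fin 4 → ℕ, ∑ j, ν j < m →
      ∑ δ : D, g δ * (dsc (ν 0) ((d : ℚ) - δ.1.1 - δ.1.2.1 - δ.1.2.2) *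
        dmon (ν 1) (ν 2) (ν 3) δ.1 * chr p δ.1) = 0 := by
    simp only [vanishingSpace, Submodule.mem_iInf, LinearMap.mem_ker]
    refine forall₂_congr fun ν _ => ?_
    change MvPolynomial.aeval (ptOf p) (diffOp ν (polyMap d D g)) = 0 ↔ _
    rw [aeval_diffOp_polyMap hD hp, mul_eq_zero]
    simp only [chr_ne_zero hp, false_or]
  rw [h0]
  constructor
  · intro h i j k hh
    have key : ∀ f ∈ PolD m, ∑ δ : D, g δ * (f δ.1 * chr p δ.1) = 0 := by
      intro f hf
      induction hf using Submodule.span_induction with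
      | mem f hf =>
        obtain ⟨i, j, k, h', rfl⟩ := hf
        have := h ![0, i, j, k] (by
          rw [Fin.sum_univ_four]
          change 0 + i + j + k < m
          omega)
        simpa [dsc] using this
      | zero => simp
      | add f f' _ _ hf hf' =>
        simp only [Pi.add_apply, add_mul, mul_add, Finset.sum_add_distrib, hf, hf', add_zero]
      | smul a f _ hf =>
        have : ∑ δ : D, g δ * ((a • f) δ.1 * chr p δ.1) =
            a * ∑ δ : D, g δ * (f δ.1 * chr p δ.1) := by
          rw [Finset.mul_sum]
          refine Finset.sum_congr rfl fun δ _ => ?_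
          simp only [Pi.smul_apply, smul_eq_mul]; ring
        rw [this, hf, mul_zero]
    exact key _ (PolD_mono (by omega) (mon_mem_PolD i j k))
  · intro h ν hν
    have key : ∀ f ∈ Pol m, ∑ δ : D, g δ * (f δ.1 * chr p δ.1) = 0 := by
      intro f hf
      induction hf using Submodule.span_induction with
      | mem f hf =>
        obtain ⟨i, j, k, h', rfl⟩ := hf
        exact h i j k h'
      | zero => simp
      | add f f' _ _ hf hf' =>
        simp only [Pi.add_apply, add_mul, mul_add, Finset.sum_add_distrib, hf, hf', add_zero]
      | smul a f _ hf =>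
        have : ∑ δ : D, g δ * ((a • f) δ.1 * chr p δ.1) =
            a * ∑ δ : D, g δ * (f δ.1 * chr p δ.1) := by
          rw [Finset.mul_sum]
          refine Finset.sum_congr rfl fun δ _ => ?_
          simp only [Pi.smul_apply, smul_eq_mul]; ring
        rw [this, hf, mul_zero]
    rw [Fin.sum_univ_four] at hν
    exact key _ (Pol_mono (by omega) (desc_mem_Pol d (ν 0) (ν 1) (ν 2) (ν 3)))

theorem systemSpace_finrank {d : ℕ} {D : Finset Z3}
    (hD : ∀ a b c, (a, b, c) ∈ D ↔ Tet d a b c) (ms : List ℕ) (q : Fin ms.length → Q3)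
    (hq : ∀ i, tor (q i)) (h4 : ∀ m ∈ ms, m ≤ 4) :
    Module.finrank ℚ (systemSpace d ms fun i => ptOf (q i)) =
      Module.finrank ℚ (KL D (List.ofFn fun i => (ms.get i, q i))) := by
  have h1 : (KL D (List.ofFn fun i => (ms.get i, q i))).map (polyMap d D) =
      systemSpace d ms fun i => ptOf (q i) := by
    have hmem : ∀ g : D → ℚ, g ∈ KL D (List.ofFn fun i => (ms.get i, q i)) ↔
        ∀ i, polyMap d D g ∈ vanishingSpace (ms.get i) (ptOf (q i)) := by
      intro g
      rw [mem_KL]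
      · simp only [List.forall_mem_ofFn_iff, mem_vanishing_iff hD (hq _)]
      · simp only [List.forall_mem_ofFn_iff]
        intro i
        exact h4 _ (List.get_mem _ _)
    ext F
    constructor
    · rintro ⟨g, hg, rfl⟩
      refine ⟨polyMap_hom hD g, ?_⟩
      rw [SetLike.mem_coe, Submodule.mem_iInf]
      exact (hmem g).1 hg
    · rintro ⟨hF, hv⟩
      obtain ⟨g, rfl⟩ := hom_le_range hD hF
      rw [SetLike.mem_coe, Submodule.mem_iInf] at hv
      exact ⟨g, (hmem g).2 hv, rfl⟩
  rw [← h1]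
  exact (Submodule.equivMapOfInjective _ (polyMap_inj hD) _).finrank_eq.symm

theorem KL_eq_bot {D : Finset Z3} {l : List (ℕ × Q3)} (hl : ∀ mp ∈ l, mp.1 ≤ 4)
    (h : ∀ c, Cond D c (l : Multiset (ℕ × Q3)) → ∀ δ ∈ D, c δ = 0) : KL D l = ⊥ := by
  classical
  rw [eq_bot_iff]
  intro g hg
  rw [mem_KL hl] at hg
  rw [Submodule.mem_bot]
  have := h (fun δ => if hδ : δ ∈ D then g ⟨δ, hδ⟩ else 0) (by
    intro mp hmp i j k hh
    rw [← hg mp (by simpa using hmp) i j k hh, ← Finset.sum_coe_sort D]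
    refine Finset.sum_congr rfl fun δ _ => ?_
    simp)
  funext δ
  simpa using this δ.1 δ.2

theorem ptOf_indep {p q : Q3} (h : p ≠ q) : LinearIndependent ℚ ![ptOf p, ptOf q] := by
  rw [LinearIndependent.pair_iff]
  intro s t hst
  have h0 := congrFun hst 0
  have h1 := congrFun hst 1
  have h2 := congrFun hst 2
  have h3 := congrFun hst 3
  simp [ptOf] at h0 h1 h2 h3
  have ht : t = -s := by linarith
  subst ht
  by_cases hs : s = 0
  · simp [hs]
  · exfalso
    apply h
    have g1 : s * (p.1 - q.1) = 0 := by linarith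
    have g2 : s * (p.2.1 - q.2.1) = 0 := by linarith
    have g3 : s * (p.2.2 - q.2.2) = 0 := by linarith
    rw [mul_eq_zero, or_iff_right hs, sub_eq_zero] at g1 g2 g3
    exact Prod.ext g1 (Prod.ext g2 g3)

theorem msOf_list (x y z w u : ℕ) : msOf x y (z + w) u =
    (((List.replicate x 4 ++ List.replicate y 3 ++ List.replicate z 2) ++
      (List.replicate w 2 ++ List.replicate u 1) : List ℕ) : Multiset ℕ) := by
  simp only [msOf, ← Multiset.coe_add, Multiset.coe_replicate, Multiset.replicate_add]
  abel

theorem nonSpecial_core {d : ℕ} {D : Finset Z3} (hD : ∀ a b c, (a, b, c) ∈ D ↔ Tet d a b c)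
    (ms ex : List ℕ) (h4 : ∀ m ∈ ms ++ ex, m ≤ 4) (hI : Inj D ((ms ++ ex : List ℕ) : Multiset ℕ))
    (hk : (ex.map fun m => (m + 2).choose 3).sum =
      (d + 3).choose 3 - (ms.map fun m => (m + 2).choose 3).sum) : nonSpecial d ms := by
  obtain ⟨Q, hQ, hnd, htor, hinj⟩ := hI
  obtain ⟨ql, rfl, hql⟩ := exists_list _ _ Q hQ
  have hlen : ql.length = ms.length + ex.length := by
    rw [← List.length_map Prod.fst, hql, List.length_append]
  have hl4 : ∀ mp ∈ ql, mp.1 ≤ 4 := fun mp hmp => h4 _ (by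
    rw [← hql]; exact List.mem_map_of_mem hmp)
  have hf : ∀ i : Fin ms.length, (ql[i.1]'(by omega)).1 = ms.get i := by
    intro i
    have : (ql.map Prod.fst)[i.1]'(by rw [List.length_map]; omega) = ms.get i := by
      simp only [hql, List.get_eq_getElem]
      rw [List.getElem_append_left]
    rw [← this, List.getElem_map]
  set q : Fin ms.length → Q3 := fun i => (ql[i.1]'(by omega)).2 with hq
  have hqt : ∀ i, tor (q i) := fun i => htor _ (by simp [hq])
  have hof : (List.ofFn fun i => (ms.get i, q i)) = ql.take ms.length := by
    apply List.ext_getElem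
    · simp [hlen]
    · intro i h1 h2
      rw [List.length_ofFn] at h1
      rw [List.getElem_ofFn, List.getElem_take]
      exact Prod.ext (hf ⟨i, h1⟩).symm rfl
  have hmap : (ql.take ms.length).map Prod.fst = ms := by
    rw [List.map_take, hql, List.take_left]
  have hmap' : (ql.drop ms.length).map Prod.fst = ex := by
    rw [List.map_drop, hql, List.drop_left]
  have s1 : ((ql.take ms.length).map fun mp => (mp.1 + 2).choose 3).sum =
      (ms.map fun m => (m + 2).choose 3).sum := by
    conv_rhs => rw [← hmap, List.map_map]
    rfl
  have s2 : ((ql.drop ms.length).map fun mp => (mp.1 + 2).choose 3).sum =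
      (ex.map fun m => (m + 2).choose 3).sum := by
    conv_rhs => rw [← hmap', List.map_map]
    rfl
  refine ⟨fun i => ptOf (q i), fun i h => ?_, fun i j hij => ptOf_indep fun h => ?_, ?_⟩
  · have := congrFun h 0
    simp [ptOf] at this
  · rw [Multiset.map_coe, Multiset.coe_nodup] at hnd
    have := (hnd.getElem_inj_iff (i := i.1) (j := j.1) (hi := by rw [List.length_map]; omega)
      (hj := by rw [List.length_map]; omega)).1 (by simpa [hq] using h)
    exact hij (Fin.ext this)
  · rw [systemSpace_finrank hD ms q hqt fun m hm => h4 m (by simp [hm]), hof]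
    have b1 := finrank_le_KL (D := D) ⊤ (ql.take ms.length)
      fun mp h => hl4 mp (List.mem_of_mem_take h)
    have b2 := finrank_le_KL (KL D (ql.take ms.length)) (ql.drop ms.length)
      fun mp h => hl4 mp (List.mem_of_mem_drop h)
    have b3 : KL D (ql.take ms.length) ⊓ KL D (ql.drop ms.length) = ⊥ := by
      rw [← KL_eq_bot hl4 hinj]
      ext g
      simp only [KL, Submodule.mem_inf, Submodule.mem_iInf]
      constructor
      · rintro ⟨h1, h2⟩ mp hmp
        rw [← List.take_append_drop ms.length ql, List.mem_append] at hmp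
        exact hmp.elim (h1 mp) (h2 mp)
      · intro h
        exact ⟨fun mp hmp => h mp (List.mem_of_mem_take hmp),
          fun mp hmp => h mp (List.mem_of_mem_drop hmp)⟩
    rw [top_inf_eq, finrank_top, Module.finrank_fintype_fun_eq_card, Fintype.card_coe,
      card_Tet hD, s1] at b1
    rw [b3, finrank_bot, s2, hk] at b2
    have hv : vdim d ms + 1 = ((d + 3).choose 3 : ℤ) -
        ((ms.map fun m => (m + 2).choose 3).sum : ℕ) := by
      rw [vdim, Nat.cast_list_sum, List.map_map]
      simp only [Function.comp_def]
      ring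
    rw [hv]
    omega

/-- `L_3(d; 4^{×x}, 3^{×y}, 2^{×z})` is non-special for all `d ≥ 9`. -/
theorem nonSpecial_of_nine_le (d x y z : ℕ) (hd : 9 ≤ d) :
    nonSpecial d (List.replicate x 4 ++ List.replicate y 3 ++ List.replicate z 2) := by
  obtain ⟨D, hD, -, hF⟩ := full_Tet d hd
  have hc := card_Tet hD
  set n := (d + 3).choose 3 with hn
  set k := n - (20 * x + 10 * y + 4 * z) with hk
  have hI : Inj D (msOf x y (z + k / 4) (k % 4)) :=
    hF x y (z + k / 4) (k % 4) (by omega) (by omega)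
  rw [msOf_list] at hI
  refine nonSpecial_core hD _ _ ?_ hI ?_
  · intro m hm
    simp only [List.mem_append, List.mem_replicate] at hm
    omega
  · have c4 : (4 + 2).choose 3 = 20 := rfl
    have c3 : (3 + 2).choose 3 = 10 := rfl
    have c2 : (2 + 2).choose 3 = 4 := rfl
    have c1 : (1 + 2).choose 3 = 1 := rfl
    simp only [List.map_append, List.map_replicate, List.sum_append, List.sum_replicate,
      smul_eq_mul, c4, c3, c2, c1]
    omega
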